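/- arXiv:math/0609175 — 3 statements merged into one kernel-verified Lean document; each statement's English description precedes it below -/
import Mathlib

section
/- Let c = 2√(π²/6). Then q(n) ∼ e^{(c/√2)√n} / (2²·3^{1/4}·n^{3/4}) as n → ∞; that is, q(n)·4·3^{1/4}·n^{3/4} / e^{(c/√2)√n} → 1. -/
/-- `p n` is the number of partitions of `n`. -/
def p (n : ℕ) : ℕ := Fintype.card (Nat.Partition n)

/-- `t n` is the number of ordered pairs `(μ, ν)` of partitions with `|μ| + |ν| = n`;
equivalently `t n = ∑ p m * p (n - m)`. -/
def t (n : ℕ) : ℕ := ∑ m ∈ Finset.range (n + 1), p m * p (n - m)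

/-- `c = 2 √(π²/6)` is the Hardy–Ramanujan constant. -/
noncomputable def c : ℝ := 2 * Real.sqrt (Real.pi ^ 2 / 6)

/-- `q n` is the number of partitions of `n` into distinct parts. -/
def q (n : ℕ) : ℕ := (Nat.Partition.distincts n).card

open Filter

namespace DistinctPartition

open Finset MeasureTheory Set

/-- Partitions of `n` into distinct parts correspond to sets of positive integers with sum `n`. -/
lemma q_eq_card_filter_powerset (n : ℕ) :
    q n = #{s ∈ (Finset.Icc 1 n).powerset | ∑ k ∈ s, k = n} := by
  unfold q Nat.Partition.distincts
  refine Finset.card_bij (fun P _ => P.parts.toFinset) ?_ ?_ ?_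
  · intro P hP
    simp only [Finset.mem_filter, Finset.mem_univ, true_and] at hP
    simp only [Finset.mem_filter, Finset.mem_powerset]
    refine ⟨fun k hk => ?_, ?_⟩
    · rw [Multiset.mem_toFinset] at hk
      exact Finset.mem_Icc.2 ⟨P.parts_pos hk, Nat.Partition.le_of_mem_parts hk⟩
    · rw [Finset.sum, Multiset.toFinset_val, hP.dedup, Multiset.map_id', P.parts_sum]
  · intro P hP Q hQ h
    simp only [Finset.mem_filter, Finset.mem_univ, true_and] at hP hQ
    have := congrArg Finset.val h
    rw [Multiset.toFinset_val, Multiset.toFinset_val, hP.dedup, hQ.dedup] at this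
    exact Nat.Partition.ext this
  · intro s hs
    simp only [Finset.mem_filter, Finset.mem_powerset] at hs
    refine ⟨⟨s.val, fun {i} hi => (Finset.mem_Icc.1 (hs.1 hi)).1, ?_⟩, ?_, ?_⟩
    · simpa only [Finset.sum, Multiset.map_id'] using hs.2
    · simpa using s.nodup
    · simp

/-- Orthogonality of the exponentials `θ ↦ exp (i m θ)` on `[-π, π]`. -/
lemma integral_exp_int_mul_I (m : ℤ) :
    ∫ θ in (-Real.pi)..Real.pi, Complex.exp (m * Complex.I * θ) =
      if m = 0 then 2 * (Real.pi : ℂ) else 0 := by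
  split_ifs with h
  · simp [h]; ring
  · rw [integral_exp_mul_complex (by simp [h])]
    have : Complex.exp (m * Complex.I * (Real.pi : ℂ)) =
        Complex.exp (m * Complex.I * ((-Real.pi : ℝ) : ℂ)) := by
      rw [Complex.exp_eq_exp_iff_exists_int]
      exact ⟨m, by push_cast; ring⟩
    rw [this, sub_self, zero_div]

/-- The characteristic function of a Bernoulli variable of parameter `x`, at frequency `α`. -/
noncomputable def bernoulliChar (x α : ℝ) : ℂ := 1 + x * (Complex.exp (α * Complex.I) - 1)

/-- The Fermi weight `1 / (eˣ + 1)`. -/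
noncomputable def fermi (x : ℝ) : ℝ := 1 / (Real.exp x + 1)

lemma one_add_exp_mul_exp (x α : ℝ) :
    1 + Complex.exp (-x + α * Complex.I) =
      ((1 + Real.exp (-x) : ℝ) : ℂ) * bernoulliChar (fermi x) α := by
  have h : (Real.exp x : ℂ) + 1 ≠ 0 := by
    have : Real.exp x + 1 ≠ 0 := by positivity
    exact_mod_cast this
  have h' : (Real.exp x : ℂ) ≠ 0 := by exact_mod_cast (Real.exp_pos x).ne'
  rw [bernoulliChar, fermi, Complex.exp_add, Real.exp_neg]
  have e : Complex.exp (-(x : ℂ)) = ((Real.exp x : ℝ) : ℂ)⁻¹ := by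
    rw [Complex.exp_neg, Complex.ofReal_exp]
  rw [e]
  push_cast [-Complex.ofReal_exp]
  field_simp
  ring

/-- Cauchy's formula for `q n` on the circle of radius `e⁻ʳ`, normalised by the value of the
generating product at `e⁻ʳ`. -/
lemma two_pi_mul_q (n : ℕ) (r : ℝ) :
    2 * (Real.pi : ℂ) * q n =
      ((Real.exp (n * r) * ∏ k ∈ Finset.Icc 1 n, (1 + Real.exp (-(k * r))) : ℝ) : ℂ) *
      ∫ θ in (-Real.pi)..Real.pi,
        (∏ k ∈ Finset.Icc 1 n, bernoulliChar (fermi (k * r)) (k * θ)) *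
          Complex.exp (-(n * θ) * Complex.I) := by
  have key : ∀ θ : ℝ, ((Real.exp (n * r) * ∏ k ∈ Finset.Icc 1 n,
      (1 + Real.exp (-(k * r))) : ℝ) : ℂ) *
      ((∏ k ∈ Finset.Icc 1 n, bernoulliChar (fermi (k * r)) (k * θ)) *
          Complex.exp (-(n * θ) * Complex.I)) =
      ∑ s ∈ (Finset.Icc 1 n).powerset, Complex.exp (n * r - (∑ k ∈ s, k : ℕ) * r) *
        Complex.exp ((((∑ k ∈ s, k : ℕ) : ℤ) - (n : ℤ) : ℤ) * Complex.I * θ) := by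
    intro θ
    have h1 : (∏ k ∈ Finset.Icc 1 n, ((1 + Real.exp (-(k * r)) : ℝ) : ℂ)) *
        (∏ k ∈ Finset.Icc 1 n, bernoulliChar (fermi (k * r)) (k * θ)) =
        ∑ s ∈ (Finset.Icc 1 n).powerset,
          Complex.exp ((∑ k ∈ s, k : ℕ) * (-r + θ * Complex.I)) := by
      rw [← Finset.prod_mul_distrib]
      simp_rw [← one_add_exp_mul_exp, Finset.prod_one_add, ← Complex.exp_sum]
      refine Finset.sum_congr rfl fun s _ => ?_
      push_cast
      rw [Finset.sum_mul]
      congr 1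
      exact Finset.sum_congr rfl fun k _ => by ring
    rw [Complex.ofReal_mul, Complex.ofReal_prod, mul_assoc, ← mul_assoc (∏ _ ∈ _, _), h1,
      Finset.sum_mul, Finset.mul_sum, Complex.ofReal_exp]
    refine Finset.sum_congr rfl fun s _ => ?_
    rw [← Complex.exp_add, ← Complex.exp_add, ← Complex.exp_add]
    congr 1
    push_cast
    ring
  rw [← intervalIntegral.integral_const_mul]
  simp_rw [key]
  rw [intervalIntegral.integral_finsetSum fun s _ =>
    (Continuous.intervalIntegrable (by fun_prop) _ _)]
  simp_rw [intervalIntegral.integral_const_mul, integral_exp_int_mul_I, sub_eq_zero,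
    Nat.cast_inj, mul_ite, mul_zero]
  rw [← Finset.sum_filter, q_eq_card_filter_powerset,
    Finset.sum_congr rfl (g := fun _ => 2 * (Real.pi : ℂ))]
  · rw [Finset.sum_const, nsmul_eq_mul, mul_comm]
  · intro s hs
    rw [(Finset.mem_filter.1 hs).2, sub_self, Complex.exp_zero, one_mul]

lemma norm_bernoulliChar_le_exp {x : ℝ} (α : ℝ) :
    ‖bernoulliChar x α‖ ≤ Real.exp (-(x * (1 - x) * (1 - Real.cos α))) := by
  have h : ‖bernoulliChar x α‖ ^ 2 = 1 - 2 * (x * (1 - x) * (1 - Real.cos α)) := by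
    rw [← Complex.normSq_eq_norm_sq, Complex.normSq_apply, bernoulliChar]
    simp only [Complex.add_re, Complex.one_re, Complex.mul_re, Complex.ofReal_re, Complex.sub_re,
      Complex.exp_ofReal_mul_I_re, Complex.ofReal_im, Complex.sub_im, Complex.exp_ofReal_mul_I_im,
      Complex.one_im, Complex.add_im, Complex.mul_im]
    linear_combination x ^ 2 * Real.sin_sq_add_cos_sq α
  refine le_of_sq_le_sq ?_ (Real.exp_pos _).le
  rw [h, ← Real.exp_nat_mul]
  have := Real.add_one_le_exp (-(2 * (x * (1 - x) * (1 - Real.cos α))))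
  rw [Nat.cast_ofNat, mul_neg]
  linarith

lemma norm_exp_mul_I_sub_taylor_le (α : ℝ) :
    ‖Complex.exp (α * Complex.I) - (1 + α * Complex.I - α ^ 2 / 2)‖ ≤ 4 * |α| ^ 3 := by
  rcases le_or_gt |α| 1 with h | h
  · have := Complex.exp_bound (x := α * Complex.I) (by simpa using h) (n := 3) (by norm_num)
    have e : ∑ m ∈ Finset.range 3, ((α : ℂ) * Complex.I) ^ m / (m.factorial : ℂ) =
        1 + α * Complex.I - α ^ 2 / 2 := by
      simp only [Finset.sum_range_succ, Finset.sum_range_zero, mul_pow, Complex.I_sq]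
      norm_num [Nat.factorial]
      ring
    rw [e] at this
    refine this.trans ?_
    have h3 : 0 ≤ |α| ^ 3 := by positivity
    norm_num [Nat.factorial]
    linarith
  · have h1 : ‖Complex.exp (α * Complex.I) - (1 + α * Complex.I - α ^ 2 / 2)‖ ≤
        1 + (1 + |α| + |α| ^ 2 / 2) := by
      refine (norm_sub_le _ _).trans ?_
      rw [Complex.norm_exp_ofReal_mul_I]
      refine add_le_add_right
        ((norm_sub_le _ _).trans (add_le_add ((norm_add_le _ _).trans ?_) ?_)) _
      · simp
      · simp
    nlinarith [sq_nonneg (|α| - 1), mul_pos (sub_pos.2 h) (sub_pos.2 h)]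

lemma abs_exp_neg_sub_le {x : ℝ} (hx : 0 ≤ x) : |Real.exp (-x) - (1 - x)| ≤ x ^ 2 := by
  have h1 := Real.add_one_le_exp (-x)
  rw [abs_of_nonneg (by linarith)]
  have h3 : Real.exp (-x) ≤ 1 / (1 + x) := by
    rw [Real.exp_neg, ← one_div]
    exact one_div_le_one_div_of_le (by linarith) (by linarith [Real.add_one_le_exp x])
  have h4 : 1 / (1 + x) ≤ 1 - x + x ^ 2 := by
    rw [div_le_iff₀ (by linarith)]
    nlinarith [pow_nonneg hx 3]
  linarith

/-- The centred characteristic function of a Bernoulli variable is close to the Gaussian one of the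
same variance. -/
lemma norm_bernoulliChar_mul_exp_sub_le {x : ℝ} (h0 : 0 ≤ x) (h1 : x ≤ 1) (α : ℝ) :
    ‖bernoulliChar x α * Complex.exp (-(x * α) * Complex.I) -
      (Real.exp (-(x * (1 - x) * α ^ 2 / 2)) : ℝ)‖ ≤ 8 * x * |α| ^ 3 + x * α ^ 4 := by
  have hA := norm_exp_mul_I_sub_taylor_le ((1 - x) * α)
  have hB := norm_exp_mul_I_sub_taylor_le (-(x * α))
  have hC := abs_exp_neg_sub_le (x := x * (1 - x) * α ^ 2 / 2)
    (by have := sub_nonneg.2 h1; positivity)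
  set A := Complex.exp (((1 - x) * α : ℝ) * Complex.I) -
    (1 + ((1 - x) * α : ℝ) * Complex.I - ((1 - x) * α : ℝ) ^ 2 / 2) with hAdef
  set B := Complex.exp ((-(x * α) : ℝ) * Complex.I) -
    (1 + (-(x * α) : ℝ) * Complex.I - (-(x * α) : ℝ) ^ 2 / 2) with hBdef
  set C := Real.exp (-(x * (1 - x) * α ^ 2 / 2)) - (1 - x * (1 - x) * α ^ 2 / 2) with hCdef
  have e : bernoulliChar x α * Complex.exp (-(x * α) * Complex.I) -
      (Real.exp (-(x * (1 - x) * α ^ 2 / 2)) : ℝ) = x * A + (1 - x) * B - (C : ℂ) := by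
    have e1 : Complex.exp (((1 - x) * α : ℝ) * Complex.I) =
        Complex.exp (α * Complex.I) * Complex.exp (-(x * α) * Complex.I) := by
      rw [← Complex.exp_add]; congr 1; push_cast; ring
    rw [hAdef, hBdef, hCdef, e1, bernoulliChar]
    push_cast
    ring
  have hx1 : 0 ≤ 1 - x := sub_nonneg.2 h1
  have hα : 0 ≤ |α| := abs_nonneg α
  have hA' : ‖(x : ℂ) * A‖ ≤ 4 * x * |α| ^ 3 := by
    rw [norm_mul, Complex.norm_real, Real.norm_of_nonneg h0]
    have : |(1 - x) * α| ^ 3 ≤ |α| ^ 3 := by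
      rw [abs_mul, abs_of_nonneg hx1]
      gcongr
      exact mul_le_of_le_one_left hα (by linarith)
    nlinarith
  have hB' : ‖(1 - (x : ℂ)) * B‖ ≤ 4 * x * |α| ^ 3 := by
    rw [norm_mul, ← Complex.ofReal_one, ← Complex.ofReal_sub, Complex.norm_real,
      Real.norm_of_nonneg hx1]
    have : |-(x * α)| ^ 3 ≤ x * |α| ^ 3 := by
      rw [abs_neg, abs_mul, abs_of_nonneg h0, mul_pow]
      gcongr
      exact pow_le_of_le_one h0 h1 (by norm_num)
    have hB0 : ‖B‖ ≤ 4 * x * |α| ^ 3 := by linarith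
    exact (mul_le_of_le_one_left (norm_nonneg _) (by linarith)).trans hB0
  have hC' : ‖(C : ℂ)‖ ≤ x * α ^ 4 := by
    rw [Complex.norm_real, Real.norm_eq_abs]
    refine hC.trans ?_
    have h4 : (x * (1 - x) * α ^ 2 / 2) ^ 2 = (x * (1 - x) ^ 2 / 4) * (x * α ^ 4) := by ring
    rw [h4]
    refine mul_le_of_le_one_left (by positivity) ?_
    nlinarith [mul_nonneg h0 hx1]
  rw [e]
  calc _ ≤ ‖(x : ℂ) * A‖ + ‖(1 - (x : ℂ)) * B‖ + ‖(C : ℂ)‖ :=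
        (norm_sub_le _ _).trans (add_le_add_left (norm_add_le _ _) _)
    _ ≤ _ := by linarith

lemma norm_prod_sub_prod_le {ι : Type*} (s : Finset ι) {a b : ι → ℂ}
    (ha : ∀ i ∈ s, ‖a i‖ ≤ 1) (hb : ∀ i ∈ s, ‖b i‖ ≤ 1) :
    ‖∏ i ∈ s, a i - ∏ i ∈ s, b i‖ ≤ ∑ i ∈ s, ‖a i - b i‖ := by
  classical
  induction s using Finset.induction_on with
  | empty => simp
  | insert j s hj ih =>
    rw [Finset.prod_insert hj, Finset.prod_insert hj, Finset.sum_insert hj]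
    have e : a j * ∏ i ∈ s, a i - b j * ∏ i ∈ s, b i =
        (a j - b j) * ∏ i ∈ s, a i + b j * (∏ i ∈ s, a i - ∏ i ∈ s, b i) := by ring
    rw [e]
    refine (norm_add_le _ _).trans (add_le_add ?_ ?_)
    · rw [norm_mul, norm_prod]
      exact mul_le_of_le_one_right (norm_nonneg _) (Finset.prod_le_one (fun _ _ => norm_nonneg _)
        fun i hi => ha i (Finset.mem_insert_of_mem hi))
    · rw [norm_mul]
      exact (mul_le_of_le_one_left (norm_nonneg _) (hb j (Finset.mem_insert_self _ _))).trans
        (ih (fun i hi => ha i (Finset.mem_insert_of_mem hi))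
          fun i hi => hb i (Finset.mem_insert_of_mem hi))

lemma fermi_nonneg (x : ℝ) : 0 ≤ fermi x := by unfold fermi; positivity

lemma fermi_le_one (x : ℝ) : fermi x ≤ 1 := by
  unfold fermi
  rw [div_le_one (by positivity)]
  linarith [Real.exp_pos x]

lemma fermi_le_exp_neg (x : ℝ) : fermi x ≤ Real.exp (-x) := by
  rw [fermi, Real.exp_neg, ← one_div]
  exact one_div_le_one_div_of_le (Real.exp_pos x) (by linarith)

lemma exp_neg_div_four_le {x : ℝ} (hx : 0 ≤ x) :
    Real.exp (-x) / 4 ≤ fermi x * (1 - fermi x) := by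
  have h1 : 1 ≤ Real.exp x := Real.one_le_exp hx
  have h2 : fermi x * (1 - fermi x) = Real.exp x / (Real.exp x + 1) ^ 2 := by
    unfold fermi; field_simp; ring
  rw [h2, Real.exp_neg, div_le_div_iff₀ (by norm_num) (by positivity),
    ← mul_le_mul_iff_right₀ (Real.exp_pos x), ← mul_assoc, mul_inv_cancel₀ (Real.exp_pos x).ne']
  nlinarith

lemma sum_exp_neg_mul_le {a : ℝ} (ha : 0 < a) (n : ℕ) :
    ∑ k ∈ Finset.Icc 1 n, Real.exp (-(k * a)) ≤ 1 / a := by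
  have h : ∀ n : ℕ, ∑ k ∈ Finset.Icc 1 n, Real.exp (-(k * a)) ≤ (1 - Real.exp (-(n * a))) / a := by
    intro n
    induction n with
    | zero => simp
    | succ n ih =>
      rw [Finset.sum_Icc_succ_top (by omega)]
      have h1 := Real.add_one_le_exp a
      have h2 : Real.exp (-(n * a)) = Real.exp (-((n + 1 : ℕ) * a)) * Real.exp a := by
        rw [← Real.exp_add]; congr 1; push_cast; ring
      rw [le_div_iff₀ ha] at ih ⊢
      nlinarith [Real.exp_pos (-((n + 1 : ℕ) * a))]
  refine (h n).trans (div_le_div_of_nonneg_right ?_ ha.le)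
  linarith [Real.exp_pos (-(n * a))]

lemma sum_fermi_mul_pow_le {r : ℝ} (hr : 0 < r) (m n : ℕ) :
    ∑ k ∈ Finset.Icc 1 n, fermi (k * r) * (k : ℝ) ^ m ≤
      m.factorial * 2 ^ (m + 1) / r ^ (m + 1) := by
  calc ∑ k ∈ Finset.Icc 1 n, fermi (k * r) * (k : ℝ) ^ m
      ≤ ∑ k ∈ Finset.Icc 1 n, (m.factorial * (2 / r) ^ m) * Real.exp (-(k * (r / 2))) := by
        refine Finset.sum_le_sum fun k _ => ?_
        have h1 := Real.pow_div_factorial_le_exp (k * (r / 2)) (by positivity) m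
        have h2 : (k : ℝ) ^ m ≤ m.factorial * (2 / r) ^ m * Real.exp (k * (r / 2)) := by
          rw [div_le_iff₀ (by positivity)] at h1
          calc (k : ℝ) ^ m = (2 / r) ^ m * (k * (r / 2)) ^ m := by
                rw [← mul_pow]; congr 1; field_simp
            _ ≤ (2 / r) ^ m * (Real.exp (k * (r / 2)) * m.factorial) := by gcongr
            _ = _ := by ring
        calc fermi (k * r) * (k : ℝ) ^ m
            ≤ Real.exp (-(k * r)) * (m.factorial * (2 / r) ^ m * Real.exp (k * (r / 2))) := by
              gcongr
              exact fermi_le_exp_neg _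
          _ = m.factorial * (2 / r) ^ m * (Real.exp (-(k * r)) * Real.exp (k * (r / 2))) := by ring
          _ = _ := by rw [← Real.exp_add]; congr 2; ring
    _ ≤ (m.factorial * (2 / r) ^ m) * (1 / (r / 2)) := by
        rw [← Finset.mul_sum]
        gcongr
        exact sum_exp_neg_mul_le (by positivity) n
    _ = _ := by rw [div_pow]; field_simp; ring

lemma abs_mul_right_sub_integral_le {f f' : ℝ → ℝ} {a b M : ℝ} (hab : a ≤ b)
    (hf : ∀ x, HasDerivAt f (f' x) x) (hM : ∀ x ∈ Set.Icc a b, |f' x| ≤ M) :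
    |(b - a) * f b - ∫ x in a..b, f x| ≤ M * (b - a) ^ 2 := by
  have hc : Continuous f := continuous_iff_continuousAt.2 fun x => (hf x).continuousAt
  have hM0 : 0 ≤ M := (abs_nonneg _).trans (hM a (Set.left_mem_Icc.2 hab))
  have e : (b - a) * f b - ∫ x in a..b, f x = ∫ x in a..b, (f b - f x) := by
    rw [intervalIntegral.integral_sub (by simp) (hc.intervalIntegrable _ _)]
    simp
  rw [e, ← Real.norm_eq_abs]
  refine (intervalIntegral.norm_integral_le_of_norm_le_const (C := M * (b - a)) ?_).trans ?_
  · intro x hx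
    rw [Set.uIoc_of_le hab] at hx
    have := (convex_Icc a b).norm_image_sub_le_of_norm_hasDerivWithin_le (f := f) (f' := f')
      (C := M) (fun y _ => (hf y).hasDerivWithinAt) hM ⟨hx.1.le, hx.2⟩ (Set.right_mem_Icc.2 hab)
    refine this.trans ?_
    rw [Real.norm_eq_abs, abs_of_nonneg (by linarith [hx.2])]
    gcongr
    exact hx.1.le
  · rw [abs_of_nonneg (sub_nonneg.2 hab)]
    exact le_of_eq (by ring)

/-- Error bound for the trapezoidal rule on a single interval. -/
lemma abs_trapezoid_sub_integral_le {f f' f'' : ℝ → ℝ} {a b M : ℝ} (hab : a ≤ b)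
    (hf : ∀ x, HasDerivAt f (f' x) x) (hf' : ∀ x, HasDerivAt f' (f'' x) x)
    (hM : ∀ x ∈ Set.Icc a b, |f'' x| ≤ M) :
    |(b - a) * ((f a + f b) / 2) - ∫ x in a..b, f x| ≤ M * (b - a) ^ 3 / 2 := by
  have hc : Continuous f := continuous_iff_continuousAt.2 fun x => (hf x).continuousAt
  have hM0 : 0 ≤ M := (abs_nonneg _).trans (hM a (Set.left_mem_Icc.2 hab))
  have hg : ∀ x, HasDerivAt (fun y => f y + f (a + b - y)) (f' x - f' (a + b - x)) x := by
    intro x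
    have h1 : HasDerivAt (fun y => a + b - y) (-1) x := (hasDerivAt_id x).const_sub _
    have h2 := (hf x).fun_add ((hf (a + b - x)).comp x h1)
    simpa [sub_eq_add_neg, Function.comp_def] using h2
  have key := abs_mul_right_sub_integral_le (M := M * (b - a)) hab hg ?_
  · have e : ∫ x in a..b, (f x + f (a + b - x)) = 2 * ∫ x in a..b, f x := by
      rw [intervalIntegral.integral_add (hc.intervalIntegrable _ _)
        (Continuous.intervalIntegrable (by fun_prop) _ _),
        intervalIntegral.integral_comp_sub_left]
      rw [add_sub_cancel_right, add_sub_cancel_left, two_mul]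
    rw [e, add_sub_cancel_right] at key
    rw [abs_le] at key ⊢
    constructor <;> nlinarith [key.1, key.2]
  · intro x hx
    have h2 : a + b - x ∈ Set.Icc a b := ⟨by linarith [hx.2], by linarith [hx.1]⟩
    refine ((convex_Icc a b).norm_image_sub_le_of_norm_hasDerivWithin_le (f := f') (f' := f'')
      (C := M) (fun y _ => (hf' y).hasDerivWithinAt) hM h2 hx).trans ?_
    gcongr
    rw [Real.norm_eq_abs, abs_le]
    constructor <;> linarith [hx.1, hx.2]

lemma exp_neg_half_le {r x : ℝ} (hr1 : r ≤ 1) (k : ℕ) (hx : k * r ≤ x) :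
    Real.exp (-x / 2) ≤ 2 * Real.exp (-((k + 1 : ℕ) * (r / 2))) := by
  have h2 : Real.exp (r / 2) ≤ 2 := by
    have h3 : Real.exp (r / 2) ^ 2 ≤ 2 ^ 2 := by
      rw [← Real.exp_nat_mul]
      have : Real.exp ((2 : ℕ) * (r / 2)) ≤ Real.exp 1 := Real.exp_le_exp.2 (by push_cast; linarith)
      linarith [Real.exp_one_lt_d9]
    exact le_of_sq_le_sq h3 (by norm_num)
  calc Real.exp (-x / 2) ≤ Real.exp (r / 2 + -((k + 1 : ℕ) * (r / 2))) :=
        Real.exp_le_exp.2 (by push_cast; linarith)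
    _ ≤ _ := by rw [Real.exp_add]; gcongr

lemma abs_sum_sub_integral_le {f f' : ℝ → ℝ} {C r : ℝ} (hC : 0 ≤ C)
    (hf : ∀ x, HasDerivAt f (f' x) x) (hb : ∀ x, 0 ≤ x → |f' x| ≤ C * Real.exp (-x / 2))
    (hr : 0 < r) (hr1 : r ≤ 1) (n : ℕ) :
    |r * ∑ k ∈ Finset.Icc 1 n, f (k * r) - ∫ x in (0 : ℝ)..(n * r), f x| ≤ 4 * C * r := by
  have hc : Continuous f := continuous_iff_continuousAt.2 fun x => (hf x).continuousAt
  have h : ∀ n : ℕ, |r * ∑ k ∈ Finset.Icc 1 n, f (k * r) - ∫ x in (0 : ℝ)..(n * r), f x| ≤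
      2 * C * r ^ 2 * ∑ k ∈ Finset.Icc 1 n, Real.exp (-(k * (r / 2))) := by
    intro n
    induction n with
    | zero => simp
    | succ n ih =>
      have hle : n * r ≤ ((n + 1 : ℕ) : ℝ) * r := by push_cast; linarith
      have e : ((n + 1 : ℕ) : ℝ) * r - n * r = r := by push_cast; ring
      have key := abs_mul_right_sub_integral_le (f := f) (f' := f')
        (M := C * (2 * Real.exp (-((n + 1 : ℕ) * (r / 2))))) hle hf
        fun x hx => (hb x ((by positivity : (0 : ℝ) ≤ n * r).trans hx.1)).trans
          (mul_le_mul_of_nonneg_left (exp_neg_half_le hr1 n hx.1) hC)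
      rw [e] at key
      rw [Finset.sum_Icc_succ_top (by omega), Finset.sum_Icc_succ_top (by omega),
        ← intervalIntegral.integral_add_adjacent_intervals (hc.intervalIntegrable 0 (n * r))
          (hc.intervalIntegrable _ _)]
      rw [abs_le] at *
      constructor <;> nlinarith [key.1, key.2, ih.1, ih.2]
  refine (h n).trans ?_
  have := sum_exp_neg_mul_le (half_pos hr) n
  calc _ ≤ 2 * C * r ^ 2 * (1 / (r / 2)) := by gcongr
    _ = _ := by field_simp; ring

lemma abs_trapezoid_sum_sub_integral_le {f f' f'' : ℝ → ℝ} {C r : ℝ} (hC : 0 ≤ C)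
    (hf : ∀ x, HasDerivAt f (f' x) x) (hf' : ∀ x, HasDerivAt f' (f'' x) x)
    (hb : ∀ x, 0 ≤ x → |f'' x| ≤ C * Real.exp (-x / 2))
    (hr : 0 < r) (hr1 : r ≤ 1) (n : ℕ) :
    |r * (∑ k ∈ Finset.Icc 1 n, f (k * r) + f 0 / 2 - f (n * r) / 2) -
      ∫ x in (0 : ℝ)..(n * r), f x| ≤ 2 * C * r ^ 2 := by
  have hc : Continuous f := continuous_iff_continuousAt.2 fun x => (hf x).continuousAt
  have h : ∀ n : ℕ, |r * (∑ k ∈ Finset.Icc 1 n, f (k * r) + f 0 / 2 - f (n * r) / 2) -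
      ∫ x in (0 : ℝ)..(n * r), f x| ≤
      C * r ^ 3 * ∑ k ∈ Finset.Icc 1 n, Real.exp (-(k * (r / 2))) := by
    intro n
    induction n with
    | zero => simp
    | succ n ih =>
      have hle : n * r ≤ ((n + 1 : ℕ) : ℝ) * r := by push_cast; linarith
      have e : ((n + 1 : ℕ) : ℝ) * r - n * r = r := by push_cast; ring
      have key := abs_trapezoid_sub_integral_le (f := f) (f' := f') (f'' := f'')
        (M := C * (2 * Real.exp (-((n + 1 : ℕ) * (r / 2))))) hle hf hf'
        fun x hx => (hb x ((by positivity : (0 : ℝ) ≤ n * r).trans hx.1)).trans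
          (mul_le_mul_of_nonneg_left (exp_neg_half_le hr1 n hx.1) hC)
      rw [e] at key
      rw [Finset.sum_Icc_succ_top (by omega), Finset.sum_Icc_succ_top (by omega),
        ← intervalIntegral.integral_add_adjacent_intervals (hc.intervalIntegrable 0 (n * r))
          (hc.intervalIntegrable _ _)]
      rw [abs_le] at *
      constructor <;> nlinarith [key.1, key.2, ih.1, ih.2]
  refine (h n).trans ?_
  have := sum_exp_neg_mul_le (half_pos hr) n
  calc _ ≤ C * r ^ 3 * (1 / (r / 2)) := by gcongr
    _ = _ := by field_simp

lemma exp_neg_half_integrableOn (a : ℝ) :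
    IntegrableOn (fun x : ℝ => Real.exp (-x / 2)) (Set.Ioi a) := by
  have := integrableOn_exp_mul_Ioi (a := -(1 / 2)) (by norm_num) a
  refine this.congr_fun (fun x _ => ?_) measurableSet_Ioi
  dsimp only
  congr 1
  ring

lemma integral_exp_neg_half (a : ℝ) :
    ∫ x in Set.Ioi a, Real.exp (-x / 2) = 2 * Real.exp (-a / 2) := by
  have := integral_exp_mul_Ioi (a := -(1 / 2)) (by norm_num) a
  rw [show (fun x : ℝ => Real.exp (-x / 2)) = fun x => Real.exp (-(1 / 2) * x) by
    funext x; congr 1; ring, this, show -a / 2 = -(1 / 2) * a by ring]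
  ring

lemma integrableOn_of_abs_le_exp_neg_half {f : ℝ → ℝ} (hc : Continuous f) {C : ℝ}
    (hb : ∀ x, 0 ≤ x → |f x| ≤ C * Real.exp (-x / 2)) : IntegrableOn f (Set.Ioi 0) := by
  refine Integrable.mono' ((exp_neg_half_integrableOn 0).const_mul C)
    hc.aestronglyMeasurable.restrict ?_
  filter_upwards [ae_restrict_mem measurableSet_Ioi] with x hx
  exact hb x (le_of_lt hx)

lemma abs_integral_sub_integral_Ioi_le {f : ℝ → ℝ} (hc : Continuous f) {C : ℝ}
    (hb : ∀ x, 0 ≤ x → |f x| ≤ C * Real.exp (-x / 2)) {a : ℝ} (ha : 0 ≤ a) :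
    |(∫ x in (0 : ℝ)..a, f x) - ∫ x in Set.Ioi 0, f x| ≤ 2 * C * Real.exp (-a / 2) := by
  have hi := integrableOn_of_abs_le_exp_neg_half hc hb
  have h := intervalIntegral.integral_interval_add_Ioi' (μ := volume)
    (hc.intervalIntegrable 0 a) (hi.mono_set (Set.Ioi_subset_Ioi ha))
  rw [← h, sub_add_cancel_left, abs_neg, ← Real.norm_eq_abs]
  refine (norm_integral_le_of_norm_le ((exp_neg_half_integrableOn a).const_mul C) ?_).trans ?_
  · filter_upwards [ae_restrict_mem measurableSet_Ioi] with x hx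
    exact hb x (ha.trans (le_of_lt hx))
  · rw [integral_const_mul, integral_exp_neg_half]
    exact le_of_eq (by ring)

/-- With `n r² = κ` fixed, the truncation error `exp (-n r / 2)` is of order `r²`. -/
lemma exp_neg_half_mul_le {κ r : ℝ} (hκ : 0 < κ) (hr : 0 < r) {n : ℕ} (hn : n * r ^ 2 = κ) :
    Real.exp (-(n * r) / 2) ≤ 8 / κ ^ 2 * r ^ 2 := by
  have h1 := Real.pow_div_factorial_le_exp (n * r / 2) (by positivity) 2
  have e : (n : ℝ) * r = κ / r := by rw [← hn]; field_simp
  rw [neg_div, Real.exp_neg]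
  calc (Real.exp (n * r / 2))⁻¹ ≤ ((n * r / 2) ^ 2 / (2 : ℕ).factorial)⁻¹ := by
        gcongr
        rw [e]
        positivity
    _ = _ := by rw [e, Nat.factorial_two]; field_simp; norm_num

lemma exists_abs_sum_sub_integral_Ioi_le {f f' : ℝ → ℝ} {C κ : ℝ} (hκ : 0 < κ)
    (hf : ∀ x, HasDerivAt f (f' x) x) (hb : ∀ x, 0 ≤ x → |f x| ≤ C * Real.exp (-x / 2))
    (hb' : ∀ x, 0 ≤ x → |f' x| ≤ C * Real.exp (-x / 2)) :
    ∃ K, ∀ (r : ℝ) (n : ℕ), 0 < r → r ≤ 1 → n * r ^ 2 = κ →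
      |r * ∑ k ∈ Finset.Icc 1 n, f (k * r) - ∫ x in Set.Ioi 0, f x| ≤ K * r := by
  have hc : Continuous f := continuous_iff_continuousAt.2 fun x => (hf x).continuousAt
  have hC : 0 ≤ C := by simpa using (abs_nonneg _).trans (hb 0 le_rfl)
  refine ⟨4 * C + 2 * C * (8 / κ ^ 2), fun r n hr hr1 hn => ?_⟩
  have h1 := abs_sum_sub_integral_le hC hf hb' hr hr1 n
  have h2 := abs_integral_sub_integral_Ioi_le hc hb (a := n * r) (by positivity)
  have h3 : 2 * C * Real.exp (-(n * r) / 2) ≤ 2 * C * (8 / κ ^ 2) * r := by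
    rw [mul_assoc (2 * C)]
    gcongr
    exact (exp_neg_half_mul_le hκ hr hn).trans (by gcongr; nlinarith)
  rw [abs_le] at *
  constructor <;> linarith [h1.1, h1.2, h2.1, h2.2]

lemma exists_abs_sum_add_half_sub_integral_Ioi_le {f f' f'' : ℝ → ℝ} {C κ : ℝ} (hκ : 0 < κ)
    (hf : ∀ x, HasDerivAt f (f' x) x) (hf' : ∀ x, HasDerivAt f' (f'' x) x)
    (hb : ∀ x, 0 ≤ x → |f x| ≤ C * Real.exp (-x / 2))
    (hb' : ∀ x, 0 ≤ x → |f'' x| ≤ C * Real.exp (-x / 2)) :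
    ∃ K, ∀ (r : ℝ) (n : ℕ), 0 < r → r ≤ 1 → n * r ^ 2 = κ →
      |r * (∑ k ∈ Finset.Icc 1 n, f (k * r) + f 0 / 2) - ∫ x in Set.Ioi 0, f x| ≤ K * r ^ 2 := by
  have hc : Continuous f := continuous_iff_continuousAt.2 fun x => (hf x).continuousAt
  have hC : 0 ≤ C := by simpa using (abs_nonneg _).trans (hb 0 le_rfl)
  refine ⟨2 * C + 3 * (C * (8 / κ ^ 2)), fun r n hr hr1 hn => ?_⟩
  have h1 := abs_trapezoid_sum_sub_integral_le hC hf hf' hb' hr hr1 n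
  have h2 := abs_integral_sub_integral_Ioi_le hc hb (a := n * r) (by positivity)
  have h3 : C * Real.exp (-(n * r) / 2) ≤ C * (8 / κ ^ 2) * r ^ 2 := by
    rw [mul_assoc C]
    gcongr
    exact exp_neg_half_mul_le hκ hr hn
  have h4 : |r * f (n * r)| ≤ C * Real.exp (-(n * r) / 2) := by
    rw [abs_mul, abs_of_pos hr]
    exact (mul_le_of_le_one_left (abs_nonneg _) hr1).trans (hb _ (by positivity))
  have h5 : 0 ≤ C * Real.exp (-(n * r) / 2) := by positivity
  rw [abs_le] at *
  constructor <;> nlinarith [h1.1, h1.2, h2.1, h2.2, h4.1, h4.2]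

/-- The logistic density `eˣ / (eˣ + 1)²`, as the variance of a Bernoulli variable. -/
noncomputable def logistic (x : ℝ) : ℝ := fermi x * (1 - fermi x)

lemma logistic_nonneg (x : ℝ) : 0 ≤ logistic x :=
  mul_nonneg (fermi_nonneg x) (sub_nonneg.2 (fermi_le_one x))

lemma logistic_le_exp_neg (x : ℝ) : logistic x ≤ Real.exp (-x) :=
  (mul_le_of_le_one_right (fermi_nonneg x) (by linarith [fermi_nonneg x])).trans
    (fermi_le_exp_neg x)

lemma hasDerivAt_fermi (x : ℝ) : HasDerivAt fermi (-logistic x) x := by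
  have h := ((Real.hasDerivAt_exp x).add_const 1).fun_inv (by positivity)
  have e : fermi = fun y => (Real.exp y + 1)⁻¹ := by funext y; simp [fermi]
  rw [e]
  convert! h using 1
  unfold logistic fermi
  field_simp
  ring

lemma hasDerivAt_logistic (x : ℝ) :
    HasDerivAt logistic (-(logistic x * (1 - 2 * fermi x))) x := by
  have h := (hasDerivAt_fermi x).fun_mul ((hasDerivAt_fermi x).const_sub 1)
  change HasDerivAt (fun y => fermi y * (1 - fermi y)) _ x
  convert! h using 1
  ring

lemma hasDerivAt_log_one_add_exp_neg (x : ℝ) :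
    HasDerivAt (fun y => Real.log (1 + Real.exp (-y))) (-fermi x) x := by
  have h := ((hasDerivAt_neg x).exp.const_add 1).log (by positivity)
  convert! h using 1
  rw [fermi, Real.exp_neg]
  field_simp

lemma exp_neg_le (x : ℝ) (hx : 0 ≤ x) : Real.exp (-x) ≤ 1 * Real.exp (-x / 2) := by
  rw [one_mul]
  exact Real.exp_le_exp.2 (by linarith)

lemma exp_neg_eq_mul (x : ℝ) :
    Real.exp (-x) = Real.exp (-x / 2) * Real.exp (-x / 2) := by
  rw [← Real.exp_add]; congr 1; ring

lemma pow_mul_exp_neg_le (m : ℕ) {x : ℝ} (hx : 0 ≤ x) :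
    x ^ m * Real.exp (-x) ≤ 2 ^ m * m.factorial * Real.exp (-x / 2) := by
  have h1 := Real.pow_div_factorial_le_exp (x / 2) (by positivity) m
  have h2 : x ^ m * Real.exp (-x / 2) ≤ 2 ^ m * m.factorial := by
    rw [neg_div, Real.exp_neg, ← div_eq_mul_inv, div_le_iff₀ (Real.exp_pos _)]
    rw [div_pow, div_div, div_le_iff₀ (by positivity)] at h1
    linarith
  rw [exp_neg_eq_mul, ← mul_assoc]
  gcongr

lemma log_one_add_exp_neg_nonneg (x : ℝ) : 0 ≤ Real.log (1 + Real.exp (-x)) :=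
  Real.log_nonneg (by linarith [Real.exp_pos (-x)])

lemma log_one_add_exp_neg_le (x : ℝ) : Real.log (1 + Real.exp (-x)) ≤ Real.exp (-x) := by
  have := Real.log_le_sub_one_of_pos (x := 1 + Real.exp (-x)) (by positivity)
  linarith

lemma abs_log_one_add_exp_neg_le (x : ℝ) (hx : 0 ≤ x) :
    |Real.log (1 + Real.exp (-x))| ≤ 1 * Real.exp (-x / 2) := by
  rw [abs_of_nonneg (log_one_add_exp_neg_nonneg x)]
  exact (log_one_add_exp_neg_le x).trans (exp_neg_le x hx)

lemma abs_logistic_le (x : ℝ) (hx : 0 ≤ x) : |logistic x| ≤ 1 * Real.exp (-x / 2) := by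
  rw [abs_of_nonneg (logistic_nonneg x)]
  exact (logistic_le_exp_neg x).trans (exp_neg_le x hx)

lemma abs_mul_fermi_le (x : ℝ) (hx : 0 ≤ x) : |x * fermi x| ≤ 3 * Real.exp (-x / 2) := by
  rw [abs_of_nonneg (mul_nonneg hx (fermi_nonneg x))]
  have h1 := pow_mul_exp_neg_le 1 hx
  norm_num at h1
  have h2 := mul_le_mul_of_nonneg_left (fermi_le_exp_neg x) hx
  linarith [Real.exp_pos (-x / 2)]

lemma abs_fermi_sub_le (x : ℝ) (hx : 0 ≤ x) :
    |fermi x - x * logistic x| ≤ 3 * Real.exp (-x / 2) := by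
  have h1 := pow_mul_exp_neg_le 1 hx
  norm_num at h1
  have h2 := mul_le_mul_of_nonneg_left (logistic_le_exp_neg x) hx
  have h3 := (fermi_le_exp_neg x).trans (exp_neg_le x hx)
  have h4 := mul_nonneg hx (logistic_nonneg x)
  have h5 := fermi_nonneg x
  have h6 := Real.exp_pos (-x / 2)
  rw [abs_le]
  constructor <;> linarith

lemma abs_sq_mul_logistic_le (x : ℝ) (hx : 0 ≤ x) :
    |x ^ 2 * logistic x| ≤ 12 * Real.exp (-x / 2) := by
  rw [abs_of_nonneg (mul_nonneg (sq_nonneg x) (logistic_nonneg x))]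
  have h1 := pow_mul_exp_neg_le 2 hx
  norm_num [Nat.factorial] at h1
  have h2 := mul_le_mul_of_nonneg_left (logistic_le_exp_neg x) (sq_nonneg x)
  linarith [Real.exp_pos (-x / 2)]

lemma hasDerivAt_mul_fermi (x : ℝ) :
    HasDerivAt (fun y => y * fermi y) (fermi x - x * logistic x) x := by
  have h := (hasDerivAt_id' x).fun_mul (hasDerivAt_fermi x)
  convert! h using 1
  ring

lemma hasDerivAt_sq_mul_logistic (x : ℝ) :
    HasDerivAt (fun y => y ^ 2 * logistic y)
      (2 * x * logistic x - x ^ 2 * (logistic x * (1 - 2 * fermi x))) x := by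
  have h := (hasDerivAt_pow 2 x).fun_mul (hasDerivAt_logistic x)
  convert! h using 1
  norm_num
  ring

lemma abs_deriv_sq_mul_logistic_le (x : ℝ) (hx : 0 ≤ x) :
    |2 * x * logistic x - x ^ 2 * (logistic x * (1 - 2 * fermi x))| ≤
      12 * Real.exp (-x / 2) := by
  have h1 := pow_mul_exp_neg_le 2 hx
  have h1' := pow_mul_exp_neg_le 1 hx
  norm_num [Nat.factorial] at h1 h1'
  have h2 := mul_le_mul_of_nonneg_left (logistic_le_exp_neg x) (sq_nonneg x)
  have h3 := mul_le_mul_of_nonneg_left (logistic_le_exp_neg x) hx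
  have h4 : |x ^ 2 * (logistic x * (1 - 2 * fermi x))| ≤ x ^ 2 * logistic x := by
    rw [abs_mul, abs_mul, abs_of_nonneg (sq_nonneg x), abs_of_nonneg (logistic_nonneg x),
      ← mul_assoc]
    refine mul_le_of_le_one_right (mul_nonneg (sq_nonneg x) (logistic_nonneg x)) ?_
    rw [abs_le]
    constructor <;> linarith [fermi_nonneg x, fermi_le_one x]
  have h5 := mul_nonneg hx (logistic_nonneg x)
  rw [abs_le] at *
  constructor <;> nlinarith [h4.1, h4.2]

lemma hasSum_alternating_zeta_two :
    HasSum (fun m : ℕ => (-1 : ℝ) ^ m * (1 / ((m : ℝ) + 1) ^ 2)) (Real.pi ^ 2 / 12) := by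
  have hz := hasSum_zeta_two
  have he : HasSum (fun k : ℕ => (1 : ℝ) / ((2 * k : ℕ) : ℝ) ^ 2) (Real.pi ^ 2 / 24) := by
    have := hz.mul_left (1 / 4)
    convert! this using 1
    · funext k; push_cast; rw [mul_pow]; ring
    · ring
  have ho : HasSum (fun k : ℕ => (1 : ℝ) / ((2 * k + 1 : ℕ) : ℝ) ^ 2) (Real.pi ^ 2 / 8) := by
    have hs : Summable (fun k : ℕ => (1 : ℝ) / ((2 * k + 1 : ℕ) : ℝ) ^ 2) :=
      hz.summable.comp_injective (i := fun k : ℕ => 2 * k + 1) fun a b h => by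
        simpa using h
    have := (HasSum.even_add_odd (f := fun n : ℕ => (1 : ℝ) / (n : ℝ) ^ 2) he hs.hasSum).unique hz
    have e : ∑' k : ℕ, (1 : ℝ) / ((2 * k + 1 : ℕ) : ℝ) ^ 2 = Real.pi ^ 2 / 8 := by linarith
    exact e ▸ hs.hasSum
  have hb : HasSum (fun n : ℕ => (-1 : ℝ) ^ (n + 1) * (1 / (n : ℝ) ^ 2)) (Real.pi ^ 2 / 12) := by
    have e : Real.pi ^ 2 / 12 = -(Real.pi ^ 2 / 24) + Real.pi ^ 2 / 8 := by ring
    rw [e]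
    refine HasSum.even_add_odd ?_ ?_
    · convert! he.neg using 2 with k
      rw [pow_succ, pow_mul]; simp
    · convert! ho using 2 with k
      rw [show 2 * k + 1 + 1 = 2 * (k + 1) by ring, pow_mul]; simp
  have := (hasSum_nat_add_iff' 1).2 hb
  simp only [Finset.sum_range_one, Nat.cast_zero] at this
  convert! this using 1
  · funext m
    rw [show m + 1 + 1 = m + 2 by ring, pow_add]
    push_cast; norm_num
  · norm_num

lemma integral_mul_exp_neg_mul {a : ℝ} (ha : 0 < a) :
    ∫ x in Set.Ioi (0 : ℝ), x * Real.exp (-(a * x)) = 1 / a ^ 2 := by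
  have h := Real.integral_rpow_mul_exp_neg_mul_Ioi (a := 2) (r := a) (by norm_num) ha
  have e : (2 : ℝ) - 1 = 1 := by norm_num
  simp only [e, Real.rpow_one, Real.Gamma_two, mul_one] at h
  rw [h]
  norm_num

lemma integral_mul_fermi : ∫ x in Set.Ioi (0 : ℝ), x * fermi x = Real.pi ^ 2 / 12 := by
  have hintegral : ∀ m : ℕ, ∫ x in Set.Ioi (0 : ℝ), x * Real.exp (-(((m : ℝ) + 1) * x)) =
      1 / ((m : ℝ) + 1) ^ 2 := fun m => integral_mul_exp_neg_mul (by positivity)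
  have hI : ∀ m : ℕ, Integrable (fun x : ℝ => (-1 : ℝ) ^ m * (x * Real.exp (-(((m : ℝ) + 1) * x))))
      (volume.restrict (Set.Ioi (0 : ℝ))) := fun m => by
    refine Integrable.const_mul ?_ _
    by_contra hcon
    have := hintegral m
    rw [integral_undef hcon] at this
    have h2 : (0 : ℝ) < 1 / ((m : ℝ) + 1) ^ 2 := by positivity
    linarith
  have hnorm : ∀ m : ℕ, ∫ x in Set.Ioi (0 : ℝ),
      ‖(-1 : ℝ) ^ m * (x * Real.exp (-(((m : ℝ) + 1) * x)))‖ = 1 / ((m : ℝ) + 1) ^ 2 := fun m => by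
    rw [← hintegral m]
    refine setIntegral_congr_fun measurableSet_Ioi fun x hx => ?_
    have hx' : (0 : ℝ) < x := hx
    rw [norm_mul, norm_pow, norm_neg, norm_one, one_pow, one_mul,
      Real.norm_of_nonneg (by positivity)]
  have hs := hasSum_integral_of_summable_integral_norm hI (by
    simp_rw [hnorm]
    have := hasSum_alternating_zeta_two.summable.abs
    simpa [abs_mul] using this)
  simp_rw [integral_const_mul, hintegral] at hs
  rw [← hs.unique hasSum_alternating_zeta_two]
  refine setIntegral_congr_fun measurableSet_Ioi fun x hx => ?_
  have hx' : (0 : ℝ) < x := hx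
  have hlt : ‖-Real.exp (-x)‖ < 1 := by
    rw [norm_neg, Real.norm_of_nonneg (Real.exp_pos _).le, Real.exp_lt_one_iff]
    linarith
  have hg := (hasSum_geometric_of_norm_lt_one hlt).mul_left (x * Real.exp (-x))
  have e : ∀ m : ℕ, (-1 : ℝ) ^ m * (x * Real.exp (-(((m : ℝ) + 1) * x))) =
      x * Real.exp (-x) * (-Real.exp (-x)) ^ m := fun m => by
    rw [neg_pow (Real.exp (-x)), ← Real.exp_nat_mul,
      show -(((m : ℝ) + 1) * x) = -x + m * -x by ring, Real.exp_add]
    ring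
  simp_rw [e]
  rw [hg.tsum_eq, fermi, Real.exp_neg, sub_neg_eq_add]
  field_simp

lemma tendsto_of_abs_le_exp_neg_half {f : ℝ → ℝ} {C : ℝ}
    (hb : ∀ x, 0 ≤ x → |f x| ≤ C * Real.exp (-x / 2)) : Tendsto f atTop (nhds 0) := by
  have h : Tendsto (fun x : ℝ => C * Real.exp (-x / 2)) atTop (nhds 0) := by
    have h1 : Tendsto (fun x : ℝ => -x / 2) atTop atBot :=
      tendsto_neg_atTop_atBot.atBot_div_const (by norm_num)
    simpa using (Real.tendsto_exp_atBot.comp h1).const_mul C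
  refine squeeze_zero_norm' ?_ h
  filter_upwards [eventually_ge_atTop 0] with x hx using hb x hx

lemma integral_log_one_add_exp_neg :
    ∫ x in Set.Ioi (0 : ℝ), Real.log (1 + Real.exp (-x)) = Real.pi ^ 2 / 12 := by
  have hc1 : Continuous fun x => Real.log (1 + Real.exp (-x)) :=
    continuous_iff_continuousAt.2 fun x => (hasDerivAt_log_one_add_exp_neg x).continuousAt
  have hc2 : Continuous fun x => x * fermi x :=
    continuous_iff_continuousAt.2 fun x => (hasDerivAt_mul_fermi x).continuousAt
  have hi1 := integrableOn_of_abs_le_exp_neg_half hc1 abs_log_one_add_exp_neg_le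
  have hi2 := integrableOn_of_abs_le_exp_neg_half hc2 abs_mul_fermi_le
  have hd : ∀ x : ℝ, HasDerivAt (fun y => y * Real.log (1 + Real.exp (-y)))
      (Real.log (1 + Real.exp (-x)) - x * fermi x) x := fun x => by
    have h := (hasDerivAt_id' x).fun_mul (hasDerivAt_log_one_add_exp_neg x)
    convert! h using 1
    ring
  have ht : Tendsto (fun y => y * Real.log (1 + Real.exp (-y))) atTop (nhds 0) := by
    refine tendsto_of_abs_le_exp_neg_half (C := 2) fun x hx => ?_
    have h1 := pow_mul_exp_neg_le 1 hx
    norm_num at h1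
    rw [abs_of_nonneg (mul_nonneg hx (log_one_add_exp_neg_nonneg x))]
    exact (mul_le_mul_of_nonneg_left (log_one_add_exp_neg_le x) hx).trans h1
  have h := integral_Ioi_of_hasDerivAt_of_tendsto' (a := 0) (fun x _ => hd x) (hi1.sub hi2) ht
  rw [integral_sub hi1 hi2, integral_mul_fermi] at h
  simp only [zero_mul, sub_zero] at h
  linarith

lemma integral_sq_mul_logistic :
    ∫ x in Set.Ioi (0 : ℝ), x ^ 2 * logistic x = 2 * (Real.pi ^ 2 / 12) := by
  have hc1 : Continuous fun x => x ^ 2 * logistic x :=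
    continuous_iff_continuousAt.2 fun x => (hasDerivAt_sq_mul_logistic x).continuousAt
  have hc2 : Continuous fun x => x * fermi x :=
    continuous_iff_continuousAt.2 fun x => (hasDerivAt_mul_fermi x).continuousAt
  have hi1 := integrableOn_of_abs_le_exp_neg_half hc1 abs_sq_mul_logistic_le
  have hi2 := (integrableOn_of_abs_le_exp_neg_half hc2 abs_mul_fermi_le).const_mul 2
  have hd : ∀ x : ℝ, HasDerivAt (fun y => y ^ 2 * fermi y)
      (2 * (x * fermi x) - x ^ 2 * logistic x) x := fun x => by
    have h := (hasDerivAt_pow 2 x).fun_mul (hasDerivAt_fermi x)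
    convert! h using 1
    norm_num
    ring
  have ht : Tendsto (fun y => y ^ 2 * fermi y) atTop (nhds 0) := by
    refine tendsto_of_abs_le_exp_neg_half (C := 8) fun x hx => ?_
    have h1 := pow_mul_exp_neg_le 2 hx
    norm_num [Nat.factorial] at h1
    rw [abs_of_nonneg (mul_nonneg (sq_nonneg x) (fermi_nonneg x))]
    exact (mul_le_mul_of_nonneg_left (fermi_le_exp_neg x) (sq_nonneg x)).trans h1
  have h := integral_Ioi_of_hasDerivAt_of_tendsto' (a := 0) (fun x _ => hd x) (hi2.sub hi1) ht
  rw [integral_sub hi2 hi1, integral_const_mul, integral_mul_fermi] at h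
  simp only [ne_eq, OfNat.ofNat_ne_zero, not_false_eq_true, zero_pow, zero_mul, sub_zero] at h
  linarith

/-- The generating product at the saddle point, up to a factor `1 + O(r)`. -/
lemma exists_abs_sum_log_sub_le :
    ∃ K, ∀ (r : ℝ) (n : ℕ), 0 < r → r ≤ 1 → n * r ^ 2 = Real.pi ^ 2 / 12 →
      |∑ k ∈ Finset.Icc 1 n, Real.log (1 + Real.exp (-(k * r))) + Real.log 2 / 2 - n * r| ≤
        K * r := by
  obtain ⟨K, hK⟩ := exists_abs_sum_add_half_sub_integral_Ioi_le (κ := Real.pi ^ 2 / 12)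
    (by positivity) hasDerivAt_log_one_add_exp_neg (fun x => (hasDerivAt_fermi x).fun_neg)
    abs_log_one_add_exp_neg_le (fun x hx => by simpa using abs_logistic_le x hx)
  refine ⟨K, fun r n hr hr1 hn => ?_⟩
  have h := hK r n hr hr1 hn
  rw [integral_log_one_add_exp_neg, ← hn] at h
  simp only [neg_zero, Real.exp_zero, one_add_one_eq_two] at h
  rw [show (n : ℝ) * r ^ 2 = r * (n * r) by ring, ← mul_sub, abs_mul, abs_of_pos hr] at h
  refine le_of_mul_le_mul_left (h.trans_eq ?_) hr
  ring

/-- The tilted mean is `n` up to `O(1 / r)`. -/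
lemma exists_abs_sum_mul_fermi_sub_le :
    ∃ K, ∀ (r : ℝ) (n : ℕ), 0 < r → r ≤ 1 → n * r ^ 2 = Real.pi ^ 2 / 12 →
      |∑ k ∈ Finset.Icc 1 n, k * fermi (k * r) - n| ≤ K / r := by
  obtain ⟨K, hK⟩ := exists_abs_sum_sub_integral_Ioi_le (κ := Real.pi ^ 2 / 12)
    (by positivity) hasDerivAt_mul_fermi abs_mul_fermi_le abs_fermi_sub_le
  refine ⟨K, fun r n hr hr1 hn => ?_⟩
  have h := hK r n hr hr1 hn
  rw [integral_mul_fermi, ← hn] at h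
  have e : r * ∑ k ∈ Finset.Icc 1 n, k * r * fermi (k * r) - n * r ^ 2 =
      r ^ 2 * (∑ k ∈ Finset.Icc 1 n, k * fermi (k * r) - n) := by
    rw [mul_sub, Finset.mul_sum, Finset.mul_sum]
    congr 1
    · exact Finset.sum_congr rfl fun k _ => by ring
    · ring
  rw [e, abs_mul, abs_of_pos (by positivity)] at h
  refine le_of_mul_le_mul_left (h.trans_eq ?_) (by positivity : 0 < r ^ 2)
  field_simp

/-- The tilted variance is asymptotic to `2 κ / r³`, where `κ = π² / 12`. -/
lemma exists_abs_sum_sq_mul_logistic_sub_le :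
    ∃ K, ∀ (r : ℝ) (n : ℕ), 0 < r → r ≤ 1 → n * r ^ 2 = Real.pi ^ 2 / 12 →
      |r ^ 3 * ∑ k ∈ Finset.Icc 1 n, (k : ℝ) ^ 2 * logistic (k * r) - 2 * (Real.pi ^ 2 / 12)| ≤
        K * r := by
  obtain ⟨K, hK⟩ := exists_abs_sum_sub_integral_Ioi_le (κ := Real.pi ^ 2 / 12)
    (by positivity) hasDerivAt_sq_mul_logistic abs_sq_mul_logistic_le abs_deriv_sq_mul_logistic_le
  refine ⟨K, fun r n hr hr1 hn => ?_⟩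
  have h := hK r n hr hr1 hn
  rw [integral_sq_mul_logistic] at h
  convert! h using 3
  rw [Finset.mul_sum, Finset.mul_sum]
  exact Finset.sum_congr rfl fun k _ => by ring

lemma geom_cos_sum_ge {r θ : ℝ} (hr : 0 < r) (hr1 : r ≤ 1) (hθ : |θ| ≤ Real.pi) (n : ℕ) :
    1 / 15 * (θ ^ 2 / (r * (r ^ 2 + θ ^ 2))) - 2 * (Real.exp (-(n * r)) / r) ≤
      ∑ k ∈ Finset.range (n + 1), Real.exp (-(k * r)) * (1 - Real.cos (k * θ)) := by
  set x := Real.exp (-r) with hx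
  set u := 1 - Real.cos θ with hu
  set z : ℂ := x * Complex.exp (θ * Complex.I) with hz
  have hx0 : 0 < x := Real.exp_pos _
  have hxr : 1 - x ≤ r := by linarith [Real.add_one_le_exp (-r)]
  have hx1 : x < 1 := by rw [hx, Real.exp_lt_one_iff]; linarith
  have hx3 : 1 / 3 ≤ x := by
    rw [hx, Real.exp_neg, ← one_div]
    refine one_div_le_one_div_of_le (Real.exp_pos r) ?_
    linarith [Real.exp_le_exp.2 hr1, Real.exp_one_lt_d9]
  have hxinv : x * (1 + r) ≤ 1 := by
    have h1 := Real.add_one_le_exp r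
    have h2 : x * Real.exp r = 1 := by rw [hx, ← Real.exp_add]; simp
    nlinarith
  have hz_norm : ‖z‖ = x := by
    rw [hz, norm_mul, Complex.norm_exp_ofReal_mul_I, mul_one, Complex.norm_real,
      Real.norm_of_nonneg hx0.le]
  have hd : 1 - x ≤ ‖1 - z‖ := by
    have := norm_sub_norm_le (1 : ℂ) z
    rwa [norm_one, hz_norm] at this
  have hz1 : 1 - z ≠ 0 := by
    rw [← norm_pos_iff]; linarith
  have hzre : z.re = x * Real.cos θ := by simp [hz, Complex.exp_ofReal_mul_I_re]
  have hzim : z.im = x * Real.sin θ := by simp [hz, Complex.exp_ofReal_mul_I_im]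
  have hsum : ∑ k ∈ Finset.range (n + 1), Real.exp (-(k * r)) * (1 - Real.cos (k * θ)) =
      ∑ k ∈ Finset.range (n + 1), x ^ k - (∑ k ∈ Finset.range (n + 1), z ^ k).re := by
    rw [Complex.re_sum, ← Finset.sum_sub_distrib]
    refine Finset.sum_congr rfl fun k _ => ?_
    have h1 : Real.exp (-(k * r)) = x ^ k := by
      rw [hx, ← Real.exp_nat_mul]; congr 1; ring
    have h2 : (z ^ k).re = x ^ k * Real.cos (k * θ) := by
      rw [hz, mul_pow, ← Complex.exp_nat_mul, ← Complex.ofReal_pow, Complex.re_ofReal_mul,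
        show (k : ℂ) * (θ * Complex.I) = ((k * θ : ℝ) : ℂ) * Complex.I by push_cast; ring,
        Complex.exp_ofReal_mul_I_re]
    rw [h1, h2]; ring
  have hgx : ∑ k ∈ Finset.range (n + 1), x ^ k = (1 - x)⁻¹ - x ^ (n + 1) / (1 - x) := by
    have := geom_sum_mul_neg x (n + 1)
    have hne : 1 - x ≠ 0 := by linarith
    field_simp
    linarith
  have hgz : ∑ k ∈ Finset.range (n + 1), z ^ k = (1 - z)⁻¹ - z ^ (n + 1) / (1 - z) := by
    have := geom_sum_mul_neg z (n + 1)
    field_simp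
    exact this
  have htail : -(x ^ (n + 1) / (1 - x)) ≤ (z ^ (n + 1) / (1 - z)).re := by
    have h1 := Complex.abs_re_le_norm (z ^ (n + 1) / (1 - z))
    rw [norm_div, norm_pow, hz_norm] at h1
    have h2 : x ^ (n + 1) / ‖1 - z‖ ≤ x ^ (n + 1) / (1 - x) :=
      div_le_div_of_nonneg_left (by positivity) (by linarith) hd
    linarith [(abs_le.1 h1).1]
  have hxtail : x ^ (n + 1) / (1 - x) ≤ Real.exp (-(n * r)) / r := by
    have h1 : Real.exp (-(n * r)) = x ^ n := by
      rw [hx, ← Real.exp_nat_mul]; congr 1; ring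
    rw [h1, div_le_div_iff₀ (by linarith) hr, pow_succ, mul_assoc]
    exact mul_le_mul_of_nonneg_left (by linarith) (by positivity)
  have hu0 : 2 / Real.pi ^ 2 * θ ^ 2 ≤ u := by
    have := Real.cos_le_one_sub_mul_cos_sq hθ
    linarith
  have hu5 : θ ^ 2 / 5 ≤ u := by
    have h1 : Real.pi ^ 2 < 10 := by nlinarith [Real.pi_lt_d2, Real.pi_pos]
    have h2 : (1 : ℝ) / 5 ≤ 2 / Real.pi ^ 2 := by
      rw [div_le_div_iff₀ (by norm_num) (by positivity)]; linarith
    nlinarith [sq_nonneg θ]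
  have hupos : 0 ≤ u := by linarith [Real.cos_le_one θ]
  have hV : (1 - x)⁻¹ - ((1 - z)⁻¹).re =
      x * (1 + x) * u / ((1 - x) * ((1 - x) ^ 2 + 2 * x * u)) := by
    have hN : Complex.normSq (1 - z) = (1 - x) ^ 2 + 2 * x * u := by
      rw [Complex.normSq_apply, Complex.sub_re, Complex.sub_im, hzre, hzim, Complex.one_re,
        Complex.one_im]
      linear_combination x ^ 2 * Real.sin_sq_add_cos_sq θ
    have hne : 1 - x ≠ 0 := by linarith
    have hne2 : (1 - x) ^ 2 + 2 * x * u ≠ 0 := by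
      have : 0 < 1 - x := by linarith
      positivity
    rw [Complex.inv_re, hN, Complex.sub_re, hzre, Complex.one_re,
      show Real.cos θ = 1 - u by rw [hu]; ring]
    field_simp
    ring
  have hVge : 1 / 15 * (θ ^ 2 / (r * (r ^ 2 + θ ^ 2))) ≤
      x * (1 + x) * u / ((1 - x) * ((1 - x) ^ 2 + 2 * x * u)) := by
    have h1x : 0 < 1 - x := by linarith
    calc 1 / 15 * (θ ^ 2 / (r * (r ^ 2 + θ ^ 2)))
        = 1 / 3 * (θ ^ 2 / 5) / (r * (r ^ 2 + θ ^ 2)) := by ring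
      _ ≤ 1 / 3 * u / (r * (r ^ 2 + 2 * u)) := by
        rw [div_le_div_iff₀ (by positivity) (by positivity)]
        have : θ ^ 2 / 5 * (r ^ 2 + 2 * u) ≤ u * (r ^ 2 + θ ^ 2) := by
          nlinarith [mul_nonneg hupos (sq_nonneg θ), mul_le_mul_of_nonneg_right hu5 (sq_nonneg r)]
        nlinarith [mul_le_mul_of_nonneg_left this hr.le]
      _ ≤ x * (1 + x) * u / ((1 - x) * ((1 - x) ^ 2 + 2 * x * u)) := by
        gcongr
        · nlinarith
        · nlinarith
  rw [hsum, hgx, hgz, Complex.sub_re]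
  linarith

lemma sum_logistic_mul_ge {r θ : ℝ} {n : ℕ} (hr : 0 < r) (hr1 : r ≤ 1) (hθ : |θ| ≤ Real.pi)
    (hn : n * r ^ 2 = Real.pi ^ 2 / 12) :
    1 / 60 * (θ ^ 2 / (r * (r ^ 2 + θ ^ 2))) - 1 ≤
      ∑ k ∈ Finset.Icc 1 n, logistic (k * r) * (1 - Real.cos (k * θ)) := by
  have h1 := geom_cos_sum_ge hr hr1 hθ n
  have h2 : Real.exp (-(n * r)) / r ≤ 2 := by
    have h3 : n * r < Real.exp (n * r) := by linarith [Real.add_one_le_exp (n * r)]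
    have hpi : 6 ≤ Real.pi ^ 2 := by nlinarith [Real.pi_gt_three]
    rw [Real.exp_neg, div_le_iff₀ hr, ← one_div, div_le_iff₀ (Real.exp_pos _)]
    nlinarith
  have h3 : ∑ k ∈ Finset.range (n + 1), Real.exp (-(k * r)) * (1 - Real.cos (k * θ)) =
      ∑ k ∈ Finset.Icc 1 n, Real.exp (-(k * r)) * (1 - Real.cos (k * θ)) := by
    symm
    refine Finset.sum_subset (fun k hk => ?_) fun k hk hk' => ?_
    · rw [Finset.mem_Icc] at hk
      exact Finset.mem_range.2 (by lia)
    · rw [Finset.mem_range] at hk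
      rw [Finset.mem_Icc] at hk'
      obtain rfl : k = 0 := by lia
      simp
  have h4 : (∑ k ∈ Finset.Icc 1 n, Real.exp (-(k * r)) * (1 - Real.cos (k * θ))) / 4 ≤
      ∑ k ∈ Finset.Icc 1 n, logistic (k * r) * (1 - Real.cos (k * θ)) := by
    rw [Finset.sum_div]
    refine Finset.sum_le_sum fun k _ => ?_
    have h5 := exp_neg_div_four_le (show 0 ≤ (k : ℝ) * r by positivity)
    have h6 := mul_le_mul_of_nonneg_right h5 (sub_nonneg.2 (Real.cos_le_one (k * θ)))
    rw [div_mul_eq_mul_div] at h6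
    exact h6
  linarith

/-- An integrable bound for the rescaled characteristic function, uniform in the scale `s`. -/
lemma exists_norm_prod_bernoulliChar_le :
    ∃ K, ∀ (s t : ℝ) (n : ℕ), 0 < s → s ≤ 1 → n * (s ^ 2) ^ 2 = Real.pi ^ 2 / 12 →
      |s ^ 3 * t| ≤ Real.pi →
      ‖∏ k ∈ Finset.Icc 1 n, bernoulliChar (fermi (k * s ^ 2)) (k * (s ^ 3 * t))‖ ≤
        K * (1 + t ^ 2)⁻¹ := by
  refine ⟨Real.exp 1 * (100 * (1 + 6 * 60 ^ 3)), fun s t n hs hs1 hn ht => ?_⟩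
  set u := t ^ 2 / (1 + s ^ 2 * t ^ 2) with hu
  have hu0 : 0 ≤ u := by positivity
  have h1 := sum_logistic_mul_ge (by positivity : 0 < s ^ 2) (pow_le_one₀ hs.le hs1) ht hn
  have e : (s ^ 3 * t) ^ 2 / (s ^ 2 * ((s ^ 2) ^ 2 + (s ^ 3 * t) ^ 2)) = u := by
    rw [hu]; field_simp
  rw [e] at h1
  have hut : u * (1 + s ^ 2 * t ^ 2) = t ^ 2 := by rw [hu]; field_simp
  have h2 : 1 + t ^ 2 ≤ 100 * (1 + u ^ 3) := by
    rcases le_or_gt (s ^ 2 * t ^ 2) 1 with h | h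
    · have h3 : t ^ 2 ≤ 2 * u := by nlinarith
      have h4 : u ≤ 1 + u ^ 3 := by
        rcases le_or_gt u 1 with h5 | h5
        · linarith [pow_nonneg hu0 3]
        · linarith [le_self_pow₀ h5.le (show 3 ≠ 0 by norm_num)]
      linarith [pow_nonneg hu0 3]
    · have h3 : 1 ≤ 2 * u * s ^ 2 := by
        have hs2 : 0 < s ^ 2 := by positivity
        have ht2 : 0 < t ^ 2 := by
          by_contra hcon
          nlinarith [sq_nonneg t]
        have : t ^ 2 ≤ t ^ 2 * (2 * u * s ^ 2) := by nlinarith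
        exact le_of_mul_le_mul_left (by linarith) ht2
      have h4 : (s ^ 3) ^ 2 * t ^ 2 ≤ 10 := by
        rw [← mul_pow, ← sq_abs]
        nlinarith [Real.pi_lt_d2, Real.pi_pos, abs_nonneg (s ^ 3 * t)]
      have h5 : 1 ≤ (2 * u * s ^ 2) ^ 3 := one_le_pow₀ h3
      have h6 : t ^ 2 ≤ 80 * u ^ 3 := by
        calc t ^ 2 ≤ t ^ 2 * (2 * u * s ^ 2) ^ 3 := le_mul_of_one_le_right (sq_nonneg t) h5
          _ = 8 * u ^ 3 * ((s ^ 3) ^ 2 * t ^ 2) := by ring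
          _ ≤ 8 * u ^ 3 * 10 := by gcongr
          _ = _ := by ring
      linarith [pow_nonneg hu0 3]
  have h3 : 1 + u ^ 3 ≤ (1 + 6 * 60 ^ 3) * Real.exp (u / 60) := by
    have h4 := Real.pow_div_factorial_le_exp (u / 60) (by positivity) 3
    have h5 := Real.one_le_exp (show 0 ≤ u / 60 by positivity)
    norm_num [Nat.factorial] at h4
    nlinarith
  rw [norm_prod]
  calc ∏ k ∈ Finset.Icc 1 n, ‖bernoulliChar (fermi (k * s ^ 2)) (k * (s ^ 3 * t))‖
      ≤ ∏ k ∈ Finset.Icc 1 n,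
        Real.exp (-(logistic (k * s ^ 2) * (1 - Real.cos (k * (s ^ 3 * t))))) :=
        Finset.prod_le_prod (fun _ _ => norm_nonneg _) fun k _ => norm_bernoulliChar_le_exp _
    _ = Real.exp (-∑ k ∈ Finset.Icc 1 n,
        logistic (k * s ^ 2) * (1 - Real.cos (k * (s ^ 3 * t)))) := by
        rw [← Real.exp_sum, Finset.sum_neg_distrib]
    _ ≤ Real.exp (1 - u / 60) := Real.exp_le_exp.2 (by linarith)
    _ ≤ _ := by
        rw [← div_eq_mul_inv, le_div_iff₀ (by positivity), Real.exp_sub, div_mul_eq_mul_div,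
          div_le_iff₀ (Real.exp_pos _)]
        have := h2.trans (mul_le_mul_of_nonneg_left h3 (by norm_num))
        calc Real.exp 1 * (1 + t ^ 2) ≤ Real.exp 1 *
            (100 * ((1 + 6 * 60 ^ 3) * Real.exp (u / 60))) := by gcongr
          _ = _ := by ring

lemma abs_exp_neg_sub_exp_neg_le {x y : ℝ} (hx : 0 ≤ x) (hy : 0 ≤ y) :
    |Real.exp (-x) - Real.exp (-y)| ≤ |x - y| := by
  wlog h : x ≤ y generalizing x y
  · rw [abs_sub_comm, abs_sub_comm x]
    exact this hy hx (le_of_not_ge h)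
  have h1 : Real.exp (-y) = Real.exp (-x) * Real.exp (-(y - x)) := by
    rw [← Real.exp_add]; congr 1; ring
  have h2 := Real.add_one_le_exp (-(y - x))
  have h3 : Real.exp (-x) ≤ 1 := Real.exp_le_one_iff.2 (by linarith)
  have h4 : Real.exp (-y) ≤ Real.exp (-x) := Real.exp_le_exp.2 (by linarith)
  rw [abs_of_nonneg (by linarith), abs_of_nonpos (by linarith), h1]
  nlinarith [Real.exp_pos (-x)]

lemma norm_prod_bernoulliChar_sub_le {s : ℝ} (hs : 0 < s) (hs1 : s ≤ 1) (t : ℝ) (n : ℕ) :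
    ‖∏ k ∈ Finset.Icc 1 n, (bernoulliChar (fermi (k * s ^ 2)) (k * (s ^ 3 * t)) *
        Complex.exp (-(((fermi (k * s ^ 2) : ℝ) : ℂ) * ((k * (s ^ 3 * t) : ℝ) : ℂ)) * Complex.I)) -
      (Real.exp (-((s ^ 2) ^ 3 * ∑ k ∈ Finset.Icc 1 n, (k : ℝ) ^ 2 * logistic (k * s ^ 2)) *
        t ^ 2 / 2) : ℝ)‖ ≤ 768 * (|t| ^ 3 + t ^ 4) * s := by
  have hY : Real.exp (-((s ^ 2) ^ 3 * ∑ k ∈ Finset.Icc 1 n, (k : ℝ) ^ 2 * logistic (k * s ^ 2)) *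
        t ^ 2 / 2) = ∏ k ∈ Finset.Icc 1 n, Real.exp (-(fermi (k * s ^ 2) *
          (1 - fermi (k * s ^ 2)) * (k * (s ^ 3 * t)) ^ 2 / 2)) := by
    rw [← Real.exp_sum]
    congr 1
    rw [Finset.sum_neg_distrib, Finset.mul_sum, neg_mul, neg_div, Finset.sum_mul, Finset.sum_div]
    congr 1
    refine Finset.sum_congr rfl fun k _ => ?_
    rw [logistic]; ring
  rw [hY, Complex.ofReal_prod]
  have hr : 0 < s ^ 2 := by positivity
  have h3 := sum_fermi_mul_pow_le hr 3 n
  have h4 := sum_fermi_mul_pow_le hr 4 n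
  norm_num [Nat.factorial] at h3 h4
  refine (norm_prod_sub_prod_le _ (fun k _ => ?_) fun k _ => ?_).trans ?_
  · rw [norm_mul]
    have h5 : ‖Complex.exp (-(((fermi (k * s ^ 2) : ℝ) : ℂ) * ((k * (s ^ 3 * t) : ℝ) : ℂ)) *
        Complex.I)‖ = 1 := by
      rw [← Complex.ofReal_mul, ← Complex.ofReal_neg, Complex.norm_exp_ofReal_mul_I]
    rw [h5, mul_one]
    refine (norm_bernoulliChar_le_exp _).trans (Real.exp_le_one_iff.2 ?_)
    have := mul_nonneg (logistic_nonneg (k * s ^ 2))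
      (sub_nonneg.2 (Real.cos_le_one (k * (s ^ 3 * t))))
    rw [logistic] at this
    linarith
  · rw [Complex.norm_real, Real.norm_of_nonneg (Real.exp_pos _).le, Real.exp_le_one_iff]
    have := mul_nonneg (logistic_nonneg (k * s ^ 2)) (sq_nonneg ((k : ℝ) * (s ^ 3 * t)))
    rw [logistic] at this
    linarith
  · calc _ ≤ ∑ k ∈ Finset.Icc 1 n, (8 * fermi (k * s ^ 2) * |k * (s ^ 3 * t)| ^ 3 +
          fermi (k * s ^ 2) * (k * (s ^ 3 * t)) ^ 4) :=
          Finset.sum_le_sum fun k _ =>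
            norm_bernoulliChar_mul_exp_sub_le (fermi_nonneg _) (fermi_le_one _) _
      _ = 8 * (s ^ 9 * |t| ^ 3) * ∑ k ∈ Finset.Icc 1 n, fermi (k * s ^ 2) * (k : ℝ) ^ 3 +
          s ^ 12 * t ^ 4 * ∑ k ∈ Finset.Icc 1 n, fermi (k * s ^ 2) * (k : ℝ) ^ 4 := by
        rw [Finset.mul_sum, Finset.mul_sum, ← Finset.sum_add_distrib]
        refine Finset.sum_congr rfl fun k _ => ?_
        rw [abs_mul, abs_mul, abs_of_nonneg (by positivity : (0 : ℝ) ≤ k),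
          abs_of_pos (by positivity : 0 < s ^ 3)]
        ring
      _ ≤ 8 * (s ^ 9 * |t| ^ 3) * (96 / (s ^ 2) ^ 4) + s ^ 12 * t ^ 4 * (768 / (s ^ 2) ^ 5) := by
        gcongr
      _ = 768 * |t| ^ 3 * s + 768 * t ^ 4 * (s * s) := by field_simp; ring
      _ ≤ 768 * |t| ^ 3 * s + 768 * t ^ 4 * (s * 1) := by gcongr
      _ = _ := by ring

/-- Convergence of the rescaled Cauchy integrand to a Gaussian, with rate. -/
lemma exists_norm_integrand_sub_le :
    ∃ K, ∀ (s t : ℝ) (n : ℕ), 0 < s → s ≤ 1 → n * (s ^ 2) ^ 2 = Real.pi ^ 2 / 12 →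
      ‖(∏ k ∈ Finset.Icc 1 n, bernoulliChar (fermi (k * s ^ 2)) (k * (s ^ 3 * t))) *
          Complex.exp (-(n * ((s ^ 3 * t : ℝ) : ℂ)) * Complex.I) -
        (Real.exp (-(Real.pi ^ 2 / 12) * t ^ 2) : ℝ)‖ ≤
      (768 * (|t| ^ 3 + t ^ 4) + K * (|t| + t ^ 2)) * s := by
  obtain ⟨K₁, hK₁⟩ := exists_abs_sum_mul_fermi_sub_le
  obtain ⟨K₂, hK₂⟩ := exists_abs_sum_sq_mul_logistic_sub_le
  refine ⟨max K₁ K₂, fun s t n hs hs1 hn => ?_⟩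
  have hr : 0 < s ^ 2 := by positivity
  have hr1 : s ^ 2 ≤ 1 := pow_le_one₀ hs.le hs1
  have h1 := hK₁ (s ^ 2) n hr hr1 hn
  have h2 := hK₂ (s ^ 2) n hr hr1 hn
  have h3 := norm_prod_bernoulliChar_sub_le hs hs1 t n
  set m := ∑ k ∈ Finset.Icc 1 n, (k : ℝ) * fermi (k * s ^ 2) with hm
  set v := (s ^ 2) ^ 3 * ∑ k ∈ Finset.Icc 1 n, (k : ℝ) ^ 2 * logistic (k * s ^ 2) with hv
  have hv0 : 0 ≤ v := mul_nonneg (by positivity)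
    (Finset.sum_nonneg fun k _ => mul_nonneg (sq_nonneg _) (logistic_nonneg _))
  set X := ∏ k ∈ Finset.Icc 1 n, (bernoulliChar (fermi (k * s ^ 2)) (k * (s ^ 3 * t)) *
    Complex.exp (-(((fermi (k * s ^ 2) : ℝ) : ℂ) * ((k * (s ^ 3 * t) : ℝ) : ℂ)) * Complex.I))
    with hX
  set φ := (m - n) * (s ^ 3 * t) with hφ
  have hprod : (∏ k ∈ Finset.Icc 1 n, bernoulliChar (fermi (k * s ^ 2)) (k * (s ^ 3 * t))) *
      Complex.exp (-(n * ((s ^ 3 * t : ℝ) : ℂ)) * Complex.I) =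
      X * Complex.exp (Complex.I * φ) := by
    rw [hX, Finset.prod_mul_distrib, mul_assoc, ← Complex.exp_sum, ← Complex.exp_add]
    congr 2
    rw [← Finset.sum_mul, Finset.sum_neg_distrib, hφ, hm]
    push_cast
    rw [show ∑ k ∈ Finset.Icc 1 n, ((fermi (k * s ^ 2) : ℝ) : ℂ) * ((k : ℂ) * (s ^ 3 * t)) =
      (∑ k ∈ Finset.Icc 1 n, (k : ℂ) * ((fermi (k * s ^ 2) : ℝ) : ℂ)) * (s ^ 3 * t) by
        rw [Finset.sum_mul]; exact Finset.sum_congr rfl fun k _ => by ring]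
    ring
  have hphase : ‖Complex.exp (Complex.I * φ) - 1‖ ≤ K₁ * |t| * s := by
    refine (Real.norm_exp_I_mul_ofReal_sub_one_le).trans ?_
    rw [Real.norm_eq_abs, hφ, abs_mul, abs_mul, abs_of_pos (by positivity : 0 < s ^ 3)]
    calc _ ≤ K₁ / s ^ 2 * (s ^ 3 * |t|) := by gcongr
      _ = _ := by field_simp
  have hgauss : ‖((Real.exp (-v * t ^ 2 / 2) : ℝ) : ℂ) -
      (Real.exp (-(Real.pi ^ 2 / 12) * t ^ 2) : ℝ)‖ ≤ K₂ * t ^ 2 * s := by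
    rw [← Complex.ofReal_sub, Complex.norm_real, Real.norm_eq_abs,
      show -v * t ^ 2 / 2 = -(v * t ^ 2 / 2) by ring, neg_mul]
    refine (abs_exp_neg_sub_exp_neg_le (by positivity) (by positivity)).trans ?_
    rw [show v * t ^ 2 / 2 - Real.pi ^ 2 / 12 * t ^ 2 =
      (v - 2 * (Real.pi ^ 2 / 12)) * (t ^ 2 / 2) by ring, abs_mul,
      abs_of_nonneg (by positivity : 0 ≤ t ^ 2 / 2)]
    have hK0 : 0 ≤ K₂ := nonneg_of_mul_nonneg_left ((abs_nonneg _).trans h2) hr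
    calc _ ≤ K₂ * s ^ 2 * (t ^ 2 / 2) := by gcongr
      _ = K₂ * t ^ 2 * (s * (s / 2)) := by ring
      _ ≤ K₂ * t ^ 2 * (s * 1) := by gcongr; linarith
      _ = _ := by ring
  have hG : ‖((Real.exp (-(Real.pi ^ 2 / 12) * t ^ 2) : ℝ) : ℂ)‖ ≤ 1 := by
    rw [Complex.norm_real, Real.norm_of_nonneg (Real.exp_pos _).le, Real.exp_le_one_iff, neg_mul]
    have : 0 ≤ Real.pi ^ 2 / 12 * t ^ 2 := by positivity
    linarith
  rw [hprod]
  set Y := ((Real.exp (-v * t ^ 2 / 2) : ℝ) : ℂ)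
  set G := ((Real.exp (-(Real.pi ^ 2 / 12) * t ^ 2) : ℝ) : ℂ)
  have hunit : ‖Complex.exp (Complex.I * φ)‖ = 1 := Complex.norm_exp_I_mul_ofReal φ
  calc ‖X * Complex.exp (Complex.I * φ) - G‖
      = ‖(X - Y) * Complex.exp (Complex.I * φ) + (Y - G) * Complex.exp (Complex.I * φ) +
        G * (Complex.exp (Complex.I * φ) - 1)‖ := by congr 1; ring
    _ ≤ ‖X - Y‖ + ‖Y - G‖ + ‖Complex.exp (Complex.I * φ) - 1‖ := by
      refine norm_add₃_le.trans ?_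
      rw [norm_mul, norm_mul, norm_mul, hunit, mul_one, mul_one]
      gcongr
      exact mul_le_of_le_one_left (norm_nonneg _) hG
    _ ≤ 768 * (|t| ^ 3 + t ^ 4) * s + K₂ * t ^ 2 * s + K₁ * |t| * s := by gcongr
    _ ≤ 768 * (|t| ^ 3 + t ^ 4) * s + max K₁ K₂ * t ^ 2 * s + max K₁ K₂ * |t| * s := by
      gcongr
      · exact le_max_right _ _
      · exact le_max_left _ _
    _ = _ := by ring

lemma integral_comp_pow_three_mul {s : ℝ} (hs : 0 < s) (f : ℝ → ℂ) :
    ∫ θ in (-Real.pi)..Real.pi, f θ =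
      (s ^ 3 : ℝ) * ∫ t, (Set.Ioc (-(Real.pi / s ^ 3)) (Real.pi / s ^ 3)).indicator
        (fun t => f (s ^ 3 * t)) t := by
  have hs3 : 0 < s ^ 3 := by positivity
  rw [MeasureTheory.integral_indicator measurableSet_Ioc,
    ← intervalIntegral.integral_of_le (neg_le_self (by positivity)), ← Complex.real_smul,
    intervalIntegral.smul_integral_comp_mul_left, mul_neg, mul_div_cancel₀ _ hs3.ne']

/-- Convergence of the rescaled Cauchy integral to the Gaussian integral. -/
lemma tendsto_integral_integrand {s : ℕ → ℝ} (hs : Tendsto s atTop (nhds 0))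
    (hpos : ∀ᶠ n in atTop, 0 < s n)
    (hκ : ∀ᶠ n : ℕ in atTop, n * (s n ^ 2) ^ 2 = Real.pi ^ 2 / 12) :
    Tendsto (fun n : ℕ => ∫ t,
      (Set.Ioc (-(Real.pi / s n ^ 3)) (Real.pi / s n ^ 3)).indicator (fun t : ℝ =>
        (∏ k ∈ Finset.Icc 1 n, bernoulliChar (fermi (k * s n ^ 2)) (k * (s n ^ 3 * t))) *
          Complex.exp (-(n * ((s n ^ 3 * t : ℝ) : ℂ)) * Complex.I)) t)
      atTop (nhds ((√(Real.pi / (Real.pi ^ 2 / 12)) : ℝ) : ℂ)) := by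
  obtain ⟨K, hK⟩ := exists_norm_prod_bernoulliChar_le
  obtain ⟨M, hM⟩ := exists_norm_integrand_sub_le
  have hone : ∀ᶠ n in atTop, s n ≤ 1 := hs.eventually_le_const one_pos
  rw [← integral_gaussian, ← integral_complex_ofReal]
  have hK0 : 0 ≤ K := by
    obtain ⟨n, h1, h2, h3⟩ := (hpos.and (hone.and hκ)).exists
    have := (norm_nonneg _).trans (hK (s n) 0 n h1 h2 h3 (by simpa using Real.pi_pos.le))
    simpa using this
  refine tendsto_integral_filter_of_dominated_convergence (fun t => K * (1 + t ^ 2)⁻¹) ?_ ?_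
    (integrable_inv_one_add_sq.const_mul K) ?_
  · refine Eventually.of_forall fun n => ?_
    refine (Continuous.aestronglyMeasurable ?_).indicator measurableSet_Ioc
    unfold bernoulliChar
    fun_prop
  · filter_upwards [hpos, hone, hκ] with n h1 h2 h3
    refine Eventually.of_forall fun t => ?_
    by_cases ht : t ∈ Set.Ioc (-(Real.pi / s n ^ 3)) (Real.pi / s n ^ 3)
    · rw [Set.indicator_of_mem ht, norm_mul]
      have h5 : ‖Complex.exp (-(n * ((s n ^ 3 * t : ℝ) : ℂ)) * Complex.I)‖ = 1 := by
        rw [← Complex.ofReal_natCast, ← Complex.ofReal_mul, ← Complex.ofReal_neg,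
          Complex.norm_exp_ofReal_mul_I]
      rw [h5, mul_one]
      refine hK (s n) t n h1 h2 h3 ?_
      have hs3 : 0 < s n ^ 3 := by positivity
      rw [abs_mul, abs_of_pos hs3, ← le_div_iff₀' hs3]
      exact abs_le.2 ⟨ht.1.le, ht.2⟩
    · rw [Set.indicator_of_notMem ht, norm_zero]
      positivity
  · refine Eventually.of_forall fun t => ?_
    rw [tendsto_iff_norm_sub_tendsto_zero]
    have hlim : Tendsto (fun n => (768 * (|t| ^ 3 + t ^ 4) + M * (|t| + t ^ 2)) * s n)
        atTop (nhds 0) := by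
      simpa using hs.const_mul (768 * (|t| ^ 3 + t ^ 4) + M * (|t| + t ^ 2))
    have hsmall : ∀ᶠ n in atTop, s n ^ 3 * |t| < Real.pi := by
      have : Tendsto (fun n => s n ^ 3 * |t|) atTop (nhds 0) := by
        simpa using (hs.pow 3).mul_const |t|
      exact this.eventually_lt_const Real.pi_pos
    refine squeeze_zero' (Eventually.of_forall fun _ => norm_nonneg _) ?_ hlim
    filter_upwards [hpos, hone, hκ, hsmall] with n h1 h2 h3 h4
    have hs3 : 0 < s n ^ 3 := by positivity
    rw [← lt_div_iff₀' hs3, abs_lt] at h4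
    rw [Set.indicator_of_mem (Set.mem_Ioc.2 ⟨h4.1, h4.2.le⟩)]
    exact hM (s n) t n h1 h2 h3

lemma q_eq_mul_integral (n : ℕ) {s : ℝ} (hs : 0 < s) :
    (q n : ℂ) = ((s ^ 3 / (2 * Real.pi) *
        Real.exp (n * s ^ 2 + ∑ k ∈ Finset.Icc 1 n, Real.log (1 + Real.exp (-(k * s ^ 2)))) : ℝ) :
        ℂ) * ∫ t, (Set.Ioc (-(Real.pi / s ^ 3)) (Real.pi / s ^ 3)).indicator (fun t : ℝ =>
        (∏ k ∈ Finset.Icc 1 n, bernoulliChar (fermi (k * s ^ 2)) (k * (s ^ 3 * t))) *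
          Complex.exp (-(n * ((s ^ 3 * t : ℝ) : ℂ)) * Complex.I)) t := by
  have h := two_pi_mul_q n (s ^ 2)
  rw [integral_comp_pow_three_mul hs] at h
  have hexp : Real.exp (n * s ^ 2 +
      ∑ k ∈ Finset.Icc 1 n, Real.log (1 + Real.exp (-(k * s ^ 2)))) =
      Real.exp (n * s ^ 2) * ∏ k ∈ Finset.Icc 1 n, (1 + Real.exp (-(k * s ^ 2))) := by
    rw [Real.exp_add, Real.exp_sum]
    congr 1
    exact Finset.prod_congr rfl fun k _ => Real.exp_log (by positivity)
  have hpi : (Real.pi : ℂ) ≠ 0 := Complex.ofReal_ne_zero.2 Real.pi_ne_zero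
  rw [hexp]
  refine mul_left_cancel₀ (mul_ne_zero two_ne_zero hpi) (h.trans ?_)
  generalize Real.exp (n * s ^ 2) * ∏ k ∈ Finset.Icc 1 n, (1 + Real.exp (-(k * s ^ 2))) = E
  rw [← mul_assoc, ← mul_assoc]
  congr 1
  push_cast
  field_simp

lemma hardyRamanujan_const :
    (Real.pi ^ 2 / 12) ^ (3 / 4 : ℝ) * (4 * (3 : ℝ) ^ (1 / 4 : ℝ)) / (2 * Real.pi) *
      Real.exp (-(Real.log 2 / 2)) * √(Real.pi / (Real.pi ^ 2 / 12)) = 1 := by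
  have hpi := Real.pi_pos
  have hexp : Real.exp (-(Real.log 2 / 2)) = 2 ^ (-(1 / 2) : ℝ) := by
    rw [Real.rpow_def_of_pos two_pos]; congr 1; ring
  have h12 : (12 : ℝ) = 2 ^ (2 : ℝ) * 3 := by norm_num
  have e1 : Real.pi / (Real.pi ^ 2 / 12) = 12 / Real.pi := by field_simp
  rw [hexp, e1, Real.sqrt_eq_rpow, Real.div_rpow (by positivity) (by norm_num),
    Real.div_rpow (by norm_num) hpi.le, h12, Real.mul_rpow (by positivity) (by norm_num),
    Real.mul_rpow (by positivity) (by norm_num), ← Real.rpow_natCast Real.pi 2,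
    ← Real.rpow_mul hpi.le, ← Real.rpow_mul two_pos.le, ← Real.rpow_mul two_pos.le]
  refine Real.log_injOn_pos (Set.mem_Ioi.2 (by positivity)) (Set.mem_Ioi.2 one_pos) ?_
  rw [Real.log_mul (by positivity) (by positivity), Real.log_mul (by positivity) (by positivity),
    Real.log_div (by positivity) (by positivity), Real.log_mul (by positivity) (by positivity),
    Real.log_div (by positivity) (by positivity), Real.log_div (by positivity) (by positivity),
    Real.log_mul (by positivity) (by positivity), Real.log_mul (by positivity) (by positivity),
    Real.log_mul (by positivity) (by positivity), Real.log_mul (by positivity) (by positivity),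
    Real.log_one, show (4 : ℝ) = 2 ^ 2 by norm_num]
  simp only [Real.log_rpow hpi, Real.log_rpow two_pos, Real.log_rpow three_pos, Real.log_pow]
  push_cast
  ring

lemma c_div_sqrt_two_mul_sqrt_eq {n : ℕ} {r : ℝ} (hr : 0 < r) (h : n * r ^ 2 = Real.pi ^ 2 / 12) :
    c / √2 * √n = 2 * (n * r) := by
  have hc : c = Real.pi * (2 / √6) := by
    rw [c, Real.sqrt_div (sq_nonneg _), Real.sqrt_sq Real.pi_pos.le]; ring
  rw [← sq_eq_sq₀ (by rw [hc]; positivity) (by positivity), c, mul_pow, div_pow, mul_pow,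
    Real.sq_sqrt (by positivity), Real.sq_sqrt (by positivity), Real.sq_sqrt (by positivity)]
  linear_combination -4 * (n : ℝ) * h

end DistinctPartition

open DistinctPartition

/-- `q n ∼ e^{(c/√2)√n} / (2² 3^{1/4} n^{3/4})` as `n → ∞`. -/
theorem distincts_asymptotic :
    Tendsto (fun n : ℕ =>
        (q n : ℝ) * (4 * (3 : ℝ) ^ (1 / 4 : ℝ) * (n : ℝ) ^ (3 / 4 : ℝ)) /
          Real.exp (c / Real.sqrt 2 * Real.sqrt n))
      atTop (nhds 1) := by
  set s : ℕ → ℝ := fun n => (Real.pi ^ 2 / 12 / n) ^ (1 / 4 : ℝ) with hs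
  have hpos : ∀ᶠ n in atTop, 0 < s n := by
    filter_upwards [eventually_gt_atTop 0] with n hn
    positivity
  have hpow (n : ℕ) : (s n ^ 2) ^ 2 = Real.pi ^ 2 / 12 / n := by
    rw [← pow_mul, hs, ← Real.rpow_natCast, ← Real.rpow_mul (by positivity)]
    norm_num
  have hκ : ∀ᶠ n : ℕ in atTop, n * (s n ^ 2) ^ 2 = Real.pi ^ 2 / 12 := by
    filter_upwards [eventually_gt_atTop 0] with n hn
    rw [hpow]; field_simp
  have hlim : Tendsto s atTop (nhds 0) := by
    have h := (tendsto_const_div_atTop_nhds_zero_nat (Real.pi ^ 2 / 12)).rpow_const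
      (p := 1 / 4) (Or.inr (by norm_num))
    rwa [Real.zero_rpow (by norm_num)] at h
  have hpow34 : ∀ᶠ n : ℕ in atTop,
      s n ^ 3 * (n : ℝ) ^ (3 / 4 : ℝ) = (Real.pi ^ 2 / 12) ^ (3 / 4 : ℝ) := by
    filter_upwards [eventually_gt_atTop 0] with n hn
    rw [hs, ← Real.rpow_natCast, ← Real.rpow_mul (by positivity),
      show (1 / 4 : ℝ) * (3 : ℕ) = 3 / 4 by norm_num,
      ← Real.mul_rpow (by positivity) (by positivity)]
    congr 1
    field_simp
  obtain ⟨K, hK⟩ := exists_abs_sum_log_sub_le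
  have hE : Tendsto (fun n : ℕ => ∑ k ∈ Finset.Icc 1 n, Real.log (1 + Real.exp (-(k * s n ^ 2))) -
      n * s n ^ 2) atTop (nhds (-(Real.log 2 / 2))) := by
    rw [tendsto_iff_norm_sub_tendsto_zero]
    have h0 : Tendsto (fun n => K * s n ^ 2) atTop (nhds 0) := by
      simpa using (hlim.pow 2).const_mul K
    refine squeeze_zero' (Eventually.of_forall fun _ => norm_nonneg _) ?_ h0
    filter_upwards [hpos, hlim.eventually_le_const one_pos, hκ] with n h1 h2 h3
    rw [Real.norm_eq_abs]
    convert! hK (s n ^ 2) n (by positivity) (pow_le_one₀ h1.le h2) h3 using 2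
    ring
  have key := (Complex.continuous_ofReal.tendsto _).comp
    ((((Real.continuous_exp.tendsto _).comp hE).const_mul
      ((Real.pi ^ 2 / 12) ^ (3 / 4 : ℝ) * (4 * (3 : ℝ) ^ (1 / 4 : ℝ)) / (2 * Real.pi))))
  replace key := key.mul (tendsto_integral_integrand hlim hpos hκ)
  rw [← Complex.ofReal_mul, hardyRamanujan_const] at key
  refine (Complex.continuous_re.tendsto _).comp key |>.congr' ?_
  filter_upwards [hpos, hκ, hpow34] with n h1 h2 h3
  rw [Function.comp_apply, ← Complex.ofReal_re ((q n : ℝ) * _ / _)]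
  congr 1
  rw [c_div_sqrt_two_mul_sqrt_eq (by positivity) h2, ← h3, mul_div_assoc (q n : ℝ),
    Complex.ofReal_mul, Complex.ofReal_natCast, q_eq_mul_integral n h1,
    mul_right_comm (Complex.ofReal _), ← Complex.ofReal_mul]
  refine congrArg (fun x : ℝ => (x : ℂ) * _) ?_
  have hexp : Real.exp (n * s n ^ 2 +
        ∑ k ∈ Finset.Icc 1 n, Real.log (1 + Real.exp (-(k * s n ^ 2)))) =
      Real.exp (2 * (n * s n ^ 2)) * Real.exp (∑ k ∈ Finset.Icc 1 n,
        Real.log (1 + Real.exp (-(k * s n ^ 2))) - n * s n ^ 2) := by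
    rw [← Real.exp_add]; congr 1; ring
  simp only [hexp, Function.comp_apply]
  generalize Real.exp (∑ k ∈ Finset.Icc 1 n,
        Real.log (1 + Real.exp (-(k * s n ^ 2))) - n * s n ^ 2) = E
  generalize s n = x
  field_simp
end

section
/- Let c = 2√(π²/6). The proportion of partitions with distinct parts satisfies q(n)/p(n) ∼ (3n)^{1/4} · e^{−c√n·(1 − 1/√2)} as n → ∞. -/
open Filter

namespace PartitionAsymptotics

open Topology MeasureTheory

/-- The exponent `M (w + 1 / w)` along the vertical line `w = 1 + u I`. -/
lemma saddle_exponent (M u : ℝ) :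
    (M : ℂ) / (1 + u * Complex.I) + M * (1 + u * Complex.I)
      = (2 * M : ℝ) + (-(M * u ^ 2) : ℝ) / (1 + u * Complex.I) := by
  have h : (1 + u * Complex.I : ℂ) ≠ 0 := by
    intro h
    simpa using congrArg Complex.re h
  push_cast
  field_simp
  linear_combination (M * u ^ 2 : ℂ) * Complex.I_sq

lemma re_real_div_one_add_mul_I (a u : ℝ) :
    ((a : ℂ) / (1 + u * Complex.I)).re = a / (1 + u ^ 2) := by
  rw [Complex.div_re]
  simp [Complex.normSq_apply]
  ring

/-- Contribution of the arcs near the positive real axis to the saddle-point integral. -/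
lemma tendsto_major_arc {F : ℂ → ℂ} {g : ℝ → ℝ} {h : ℝ → ℝ → ℂ} {A B K x₀ : ℝ}
    (hA : 0 < A) (hK : 0 < K) (hx₀ : 0 < x₀)
    (hFc : ∀ x : ℝ, 0 < x → Continuous fun y : ℝ => F (x + y * Complex.I))
    (hg : ∀ x, 0 < x → 0 < g x)
    (hmaj : ∀ x, 0 < x → x < x₀ → ∀ u, |u| ≤ K →
      F (x * (1 + u * Complex.I)) = g x * Complex.exp (A / (x * (1 + u * Complex.I))) * h x u)
    (hB : ∀ x, 0 < x → x < x₀ → ∀ u, |u| ≤ K → ‖h x u‖ ≤ B)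
    (hlim : Tendsto (fun z : ℝ × ℝ => h z.1 z.2) (𝓝[>] 0 ×ˢ 𝓝 0) (𝓝 1)) :
    Tendsto (fun M : ℝ => (∫ y in -(K * (A / M))..K * (A / M),
        F ((A / M : ℝ) + y * Complex.I) *
          Complex.exp ((M / (A / M) : ℝ) * ((A / M : ℝ) + y * Complex.I))) /
      ((g (A / M) * Real.exp (2 * M) * (A / M / √M) : ℝ) : ℂ)) atTop (𝓝 (√Real.pi : ℝ)) := by
  set G : ℝ → ℝ → ℂ := fun M v => (F ((A / M : ℝ) + (A / M / √M * v : ℝ) * Complex.I) *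
      Complex.exp ((M / (A / M) : ℝ) * ((A / M : ℝ) + (A / M / √M * v : ℝ) * Complex.I))) /
      ((g (A / M) * Real.exp (2 * M) : ℝ) : ℂ) with hG
  have hxt : Tendsto (fun M : ℝ => A / M) atTop (𝓝[>] 0) := by
    rw [tendsto_nhdsWithin_iff]
    exact ⟨tendsto_const_nhds.div_atTop tendsto_id,
      (eventually_gt_atTop 0).mono fun M hM => div_pos hA hM⟩
  have hsmall : ∀ᶠ M : ℝ in atTop, A / M < x₀ :=
    (hxt.mono_right nhdsWithin_le_nhds).eventually (gt_mem_nhds hx₀)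
  -- the rescaled integrand
  have hGeq : ∀ M v : ℝ, 0 < M → A / M < x₀ → |v| ≤ K * √M →
      G M v = Complex.exp ((-(v ^ 2) : ℝ) / (1 + (v / √M : ℝ) * Complex.I)) *
        h (A / M) (v / √M) := by
    intro M v hM hMx hv
    have hs : 0 < √M := Real.sqrt_pos.2 hM
    have hx : 0 < A / M := div_pos hA hM
    have hu : |v / √M| ≤ K := by
      rw [abs_div, abs_of_pos hs, div_le_iff₀ hs]; exact hv
    have e1 : ((A / M : ℝ) : ℂ) + (A / M / √M * v : ℝ) * Complex.I
        = (A / M : ℝ) * (1 + (v / √M : ℝ) * Complex.I) := by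
      push_cast; ring
    have hMc : (M : ℂ) ≠ 0 := by exact_mod_cast hM.ne'
    have hAc : (A : ℂ) ≠ 0 := by exact_mod_cast hA.ne'
    have e2 : (A : ℂ) / ((A / M : ℝ) * (1 + (v / √M : ℝ) * Complex.I))
        + (M / (A / M) : ℝ) * ((A / M : ℝ) * (1 + (v / √M : ℝ) * Complex.I))
        = (2 * M : ℝ) + (-(v ^ 2) : ℝ) / (1 + (v / √M : ℝ) * Complex.I) := by
      have h3 : M * (v / √M) ^ 2 = v ^ 2 := by
        rw [div_pow, Real.sq_sqrt hM.le]; field_simp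
      rw [← h3, ← saddle_exponent]
      congr 1
      · rw [← div_div]; congr 1; push_cast; field_simp
      · rw [← mul_assoc]; congr 1; push_cast; field_simp
    have hgc : ((g (A / M) * Real.exp (2 * M) : ℝ) : ℂ) ≠ 0 := by
      exact_mod_cast (mul_pos (hg _ hx) (Real.exp_pos _)).ne'
    rw [hG]
    simp only
    rw [e1, hmaj _ hx hMx _ hu, div_eq_iff hgc]
    rw [show ∀ a b c d : ℂ, a * b * c * d = a * c * (b * d) by intros; ring, ← Complex.exp_add,
      e2, Complex.exp_add]
    push_cast
    ring
  have hGc : ∀ M, 0 < M → Continuous (G M) := by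
    intro M hM
    have h1 := (hFc (A / M) (div_pos hA hM)).comp
      (continuous_const.mul continuous_id : Continuous fun v : ℝ => A / M / √M * v)
    refine (h1.mul ?_).div_const _
    fun_prop
  have hdom : Tendsto (fun M : ℝ => ∫ v : ℝ,
      (Set.Ioc (-(K * √M)) (K * √M)).indicator (G M) v) atTop
      (𝓝 (∫ v : ℝ, ((Real.exp (-1 * v ^ 2) : ℝ) : ℂ))) := by
    apply tendsto_integral_filter_of_dominated_convergence
      (fun v => B * Real.exp (-(1 / (1 + K ^ 2)) * v ^ 2))
    · filter_upwards [eventually_gt_atTop 0] with M hM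
      exact (hGc M hM).aestronglyMeasurable.indicator measurableSet_Ioc
    · filter_upwards [eventually_gt_atTop 0, hsmall] with M hM hMx
      refine ae_of_all _ fun v => ?_
      have hs : 0 < √M := Real.sqrt_pos.2 hM
      have hB0 : 0 ≤ B := (norm_nonneg _).trans
        (hB _ (div_pos hA hM) hMx 0 (by simpa using hK.le))
      by_cases hv : v ∈ Set.Ioc (-(K * √M)) (K * √M)
      · have hv' : |v| ≤ K * √M := abs_le.2 ⟨hv.1.le, hv.2⟩
        have hu : |v / √M| ≤ K := by
          rw [abs_div, abs_of_pos hs, div_le_iff₀ hs]; exact hv'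
        rw [Set.indicator_of_mem hv, hGeq M v hM hMx hv', norm_mul, mul_comm]
        refine mul_le_mul (hB _ (div_pos hA hM) hMx _ hu) ?_ (norm_nonneg _) hB0
        rw [Complex.norm_exp, re_real_div_one_add_mul_I, Real.exp_le_exp]
        have h4 : (v / √M) ^ 2 ≤ K ^ 2 := sq_le_sq' (abs_le.1 hu).1 (abs_le.1 hu).2
        rw [neg_div, neg_mul, neg_le_neg_iff, one_div, inv_mul_eq_div]
        gcongr
      · rw [Set.indicator_of_notMem hv]
        simp only [norm_zero]
        positivity
    · exact (integrable_exp_neg_mul_sq (by positivity)).const_mul B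
    · refine ae_of_all _ fun v => ?_
      have hst : Tendsto (fun M : ℝ => √M) atTop atTop := Real.tendsto_sqrt_atTop
      have hvt : Tendsto (fun M : ℝ => v / √M) atTop (𝓝 0) :=
        tendsto_const_nhds.div_atTop hst
      have hl1 : Tendsto (fun M : ℝ => h (A / M) (v / √M)) atTop (𝓝 1) :=
        hlim.comp (hxt.prodMk hvt)
      have hl2 : Tendsto (fun M : ℝ =>
          Complex.exp ((-(v ^ 2) : ℝ) / (1 + (v / √M : ℝ) * Complex.I))) atTop
          (𝓝 (Complex.exp ((-(v ^ 2) : ℝ) / (1 + (0 : ℝ) * Complex.I)))) := by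
        refine (Complex.continuous_exp.tendsto _).comp ?_
        refine tendsto_const_nhds.div ?_ (by simp)
        exact tendsto_const_nhds.add
          (((Complex.continuous_ofReal.tendsto _).comp hvt).mul_const _)
      have hl3 := hl2.mul hl1
      have : Complex.exp ((-(v ^ 2) : ℝ) / (1 + (0 : ℝ) * Complex.I)) * 1
          = ((Real.exp (-1 * v ^ 2) : ℝ) : ℂ) := by
        push_cast; simp
      rw [this] at hl3
      refine hl3.congr' ?_
      filter_upwards [eventually_gt_atTop 0, hsmall, hst.eventually_gt_atTop (|v| / K)]
        with M hM hMx hMv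
      have hv' : |v| < K * √M := by rwa [div_lt_iff₀' hK] at hMv
      have hmem : v ∈ Set.Ioc (-(K * √M)) (K * √M) := ⟨(abs_lt.1 hv').1, (abs_lt.1 hv').2.le⟩
      rw [Set.indicator_of_mem hmem, hGeq M v hM hMx hv'.le]
  have hval : (∫ v : ℝ, ((Real.exp (-1 * v ^ 2) : ℝ) : ℂ)) = (√Real.pi : ℝ) := by
    rw [integral_complex_ofReal, integral_gaussian, div_one]
  rw [hval] at hdom
  refine hdom.congr' ?_
  filter_upwards [eventually_gt_atTop 0] with M hM
  have hs : 0 < √M := Real.sqrt_pos.2 hM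
  have hk : A / M / √M ≠ 0 := by positivity
  rw [integral_indicator measurableSet_Ioc,
    ← intervalIntegral.integral_of_le (by nlinarith [mul_pos hK hs])]
  have hlim1 : A / M / √M * (K * √M) = K * (A / M) := by field_simp
  simp only [hG]
  rw [intervalIntegral.integral_div, intervalIntegral.integral_comp_mul_left
    (fun y : ℝ => F ((A / M : ℝ) + y * Complex.I) *
      Complex.exp ((M / (A / M) : ℝ) * ((A / M : ℝ) + y * Complex.I))) hk]
  rw [mul_neg, hlim1, Complex.real_smul]
  push_cast
  rw [← div_div]
  ring

/-- Saddle-point asymptotics for the integral of `F(s) e^{M² s / A}` over the vertical segment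
with real part `A / M`, where `F` behaves like `g(Re s) e^{A / s}` near `0`. -/
theorem tendsto_saddle_point {F : ℂ → ℂ} {g : ℝ → ℝ} {h : ℝ → ℝ → ℂ} {A B K δ x₀ : ℝ}
    (hA : 0 < A) (hK : 0 < K) (hδ : 0 < δ) (hx₀ : 0 < x₀)
    (hFc : ∀ x : ℝ, 0 < x → Continuous fun y : ℝ => F (x + y * Complex.I))
    (hg : ∀ x, 0 < x → 0 < g x)
    (hmaj : ∀ x, 0 < x → x < x₀ → ∀ u, |u| ≤ K →
      F (x * (1 + u * Complex.I)) = g x * Complex.exp (A / (x * (1 + u * Complex.I))) * h x u)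
    (hB : ∀ x, 0 < x → x < x₀ → ∀ u, |u| ≤ K → ‖h x u‖ ≤ B)
    (hlim : Tendsto (fun z : ℝ × ℝ => h z.1 z.2) (𝓝[>] 0 ×ˢ 𝓝 0) (𝓝 1))
    (hmin : ∀ x, 0 < x → x < x₀ → ∀ y, K * x ≤ |y| → |y| ≤ Real.pi →
      ‖F (x + y * Complex.I)‖ ≤ g x * (B * Real.exp ((A - δ) / x))) :
    Tendsto (fun M : ℝ => (∫ y in -Real.pi..Real.pi,
        F ((A / M : ℝ) + y * Complex.I) *
          Complex.exp ((M / (A / M) : ℝ) * ((A / M : ℝ) + y * Complex.I))) /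
      ((g (A / M) * Real.exp (2 * M) * (A / M / √M) : ℝ) : ℂ)) atTop (𝓝 (√Real.pi : ℝ)) := by
  have hmain := tendsto_major_arc hA hK hx₀ hFc hg hmaj hB hlim
  set E : ℝ → ℝ → ℂ := fun M y => F ((A / M : ℝ) + y * Complex.I) *
          Complex.exp ((M / (A / M) : ℝ) * ((A / M : ℝ) + y * Complex.I)) with hE
  have hxt : Tendsto (fun M : ℝ => A / M) atTop (𝓝 0) :=
    tendsto_const_nhds.div_atTop tendsto_id
  have herr : Tendsto (fun M : ℝ =>
      ((∫ y in -Real.pi..-(K * (A / M)), E M y) + ∫ y in (K * (A / M))..Real.pi, E M y) /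
      ((g (A / M) * Real.exp (2 * M) * (A / M / √M) : ℝ) : ℂ)) atTop (𝓝 0) := by
    have hb : Tendsto (fun M : ℝ => 2 * Real.pi * B / A * (M ^ (3 / 2 : ℝ) *
        Real.exp (-(δ / A) * M))) atTop (𝓝 0) := by
      simpa using (tendsto_rpow_mul_exp_neg_mul_atTop_nhds_zero (3 / 2) (δ / A)
        (by positivity)).const_mul (2 * Real.pi * B / A)
    refine squeeze_zero_norm' ?_ hb
    have hKx : ∀ᶠ M : ℝ in atTop, K * (A / M) < Real.pi := by
      have := hxt.const_mul K
      rw [mul_zero] at this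
      exact this.eventually (gt_mem_nhds Real.pi_pos)
    filter_upwards [eventually_gt_atTop 0, hxt.eventually (gt_mem_nhds hx₀), hKx]
      with M hM hMx hKM
    have hs : 0 < √M := Real.sqrt_pos.2 hM
    have hx : 0 < A / M := div_pos hA hM
    have hB0 : 0 ≤ B := (norm_nonneg _).trans (hB _ hx hMx 0 (by simpa using hK.le))
    have hEb : ∀ y, K * (A / M) ≤ |y| → |y| ≤ Real.pi →
        ‖E M y‖ ≤ g (A / M) * (B * Real.exp (2 * M - δ / A * M)) := by
      intro y h1 h2
      have h3 := hmin _ hx hMx y h1 h2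
      have h4 : ((M / (A / M) : ℝ) * ((A / M : ℝ) + y * Complex.I)).re = M := by
        rw [Complex.re_ofReal_mul]
        simp
        field_simp
      rw [hE]
      simp only
      rw [norm_mul, Complex.norm_exp, h4]
      calc _ ≤ g (A / M) * (B * Real.exp ((A - δ) / (A / M))) * Real.exp M := by gcongr
        _ = g (A / M) * (B * (Real.exp ((A - δ) / (A / M)) * Real.exp M)) := by ring
        _ = _ := by
          rw [← Real.exp_add]
          congr 3
          field_simp
          ring
    have hgp := hg _ hx
    set b := g (A / M) * (B * Real.exp (2 * M - δ / A * M)) with hbdef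
    have hb0 : 0 ≤ b := by positivity
    have i1 : ‖∫ y in -Real.pi..-(K * (A / M)), E M y‖ ≤ b * Real.pi := by
      refine (intervalIntegral.norm_integral_le_of_norm_le_const (C := b) fun y hy => ?_).trans ?_
      · rw [Set.uIoc_of_le (by linarith)] at hy
        have hyneg : y ≤ 0 := hy.2.trans (by nlinarith [mul_pos hK hx])
        apply hEb <;> rw [abs_of_nonpos hyneg]
        · linarith [hy.2]
        · linarith [hy.1]
      · gcongr
        rw [abs_le]
        constructor <;> nlinarith [mul_pos hK hx, Real.pi_pos]
    have i2 : ‖∫ y in (K * (A / M))..Real.pi, E M y‖ ≤ b * Real.pi := by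
      refine (intervalIntegral.norm_integral_le_of_norm_le_const (C := b) fun y hy => ?_).trans ?_
      · rw [Set.uIoc_of_le hKM.le] at hy
        have hypos : 0 ≤ y := (mul_pos hK hx).le.trans hy.1.le
        apply hEb <;> rw [abs_of_nonneg hypos]
        · exact hy.1.le
        · exact hy.2
      · gcongr
        rw [abs_le]
        constructor <;> nlinarith [mul_pos hK hx, Real.pi_pos]
    have hD : 0 < g (A / M) * Real.exp (2 * M) * (A / M / √M) := by positivity
    rw [norm_div, Complex.norm_real, Real.norm_of_nonneg hD.le, div_le_iff₀ hD]
    refine (norm_add_le _ _).trans ((add_le_add i1 i2).trans (le_of_eq ?_))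
    have hpow : M ^ (3 / 2 : ℝ) = M * √M := by
      rw [Real.sqrt_eq_rpow, ← Real.rpow_one_add' hM.le (by norm_num)]
      norm_num
    rw [hbdef, hpow, show 2 * M - δ / A * M = 2 * M + -(δ / A) * M by ring, Real.exp_add]
    field_simp
    ring
  have hsum := hmain.add herr
  rw [add_zero] at hsum
  refine hsum.congr' ?_
  filter_upwards [eventually_gt_atTop 0] with M hM
  have hEc : Continuous (E M) := by
    refine (hFc (A / M) (div_pos hA hM)).mul ?_
    fun_prop
  rw [← add_div]
  congr 1
  rw [← add_assoc, add_comm (∫ y in -(K * (A / M))..K * (A / M), E M y),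
    intervalIntegral.integral_add_adjacent_intervals (hEc.intervalIntegrable _ _)
      (hEc.intervalIntegrable _ _),
    intervalIntegral.integral_add_adjacent_intervals (hEc.intervalIntegrable _ _)
      (hEc.intervalIntegrable _ _)]

/-- The generating function `∑ a(n) e^{-n s}`. -/
noncomputable def expSeries (a : ℕ → ℝ) (s : ℂ) : ℂ :=
  ∑' n : ℕ, (a n : ℂ) * Complex.exp (-(n * s))

lemma norm_expSeries_term (a : ℕ → ℝ) (n : ℕ) (s : ℂ) :
    ‖(a n : ℂ) * Complex.exp (-(n * s))‖ = |a n| * Real.exp (-(n * s.re)) := by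
  rw [norm_mul, Complex.norm_exp, Complex.norm_real, Real.norm_eq_abs]
  simp

lemma continuous_expSeries_vertical {a : ℕ → ℝ} {x : ℝ}
    (ha : Summable fun n : ℕ => |a n| * Real.exp (-(n * x))) :
    Continuous fun y : ℝ => expSeries a (x + y * Complex.I) := by
  refine continuous_tsum (fun n => by fun_prop) ha fun n y => ?_
  rw [norm_expSeries_term]
  simp

lemma integral_exp_int_mul_I (k : ℤ) :
    ∫ y in -Real.pi..Real.pi, Complex.exp (k * Complex.I * y)
      = if k = 0 then (2 * Real.pi : ℂ) else 0 := by
  split_ifs with hk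
  · simp [hk]; ring
  · have hc : (k * Complex.I : ℂ) ≠ 0 := mul_ne_zero (by exact_mod_cast hk) Complex.I_ne_zero
    rw [integral_exp_mul_complex hc, div_eq_zero_iff]
    left
    rw [sub_eq_zero, Complex.exp_eq_exp_iff_exists_int]
    refine ⟨k, ?_⟩
    push_cast
    ring

/-- Cauchy's formula for the coefficients of an exponential series. -/
lemma integral_expSeries_mul_exp {a : ℕ → ℝ} {x : ℝ}
    (ha : Summable fun n : ℕ => |a n| * Real.exp (-(n * x))) (m : ℕ) :
    ∫ y in -Real.pi..Real.pi, expSeries a (x + y * Complex.I) *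
      Complex.exp (m * (x + y * Complex.I)) = 2 * Real.pi * a m := by
  have key := intervalIntegral.hasSum_integral_of_dominated_convergence (μ := volume)
    (a := -Real.pi) (b := Real.pi)
    (F := fun (n : ℕ) (y : ℝ) => (a n : ℂ) * Complex.exp (-(n * (x + y * Complex.I))) *
      Complex.exp (m * (x + y * Complex.I)))
    (f := fun y => expSeries a (x + y * Complex.I) * Complex.exp (m * (x + y * Complex.I)))
    (fun n _ => |a n| * Real.exp (-(n * x)) * Real.exp (m * x))
    (fun n => (by fun_prop : Continuous _).aestronglyMeasurable)
    (fun n => ae_of_all _ fun y _ => by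
      rw [norm_mul, norm_expSeries_term, Complex.norm_exp]; simp)
    (ae_of_all _ fun y _ => ha.mul_right _) (by simp)
    (ae_of_all _ fun y _ => by
      refine HasSum.mul_right _ (Summable.hasSum ?_)
      refine Summable.of_norm ?_
      simp_rw [norm_expSeries_term]
      simpa using ha)
  have hterm : ∀ n : ℕ, (∫ y in -Real.pi..Real.pi, (a n : ℂ) *
      Complex.exp (-(n * (x + y * Complex.I))) * Complex.exp (m * (x + y * Complex.I)))
      = if n = m then 2 * Real.pi * (a m : ℂ) else 0 := by
    intro n
    have : ∀ y : ℝ, (a n : ℂ) *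
        Complex.exp (-(n * (x + y * Complex.I))) * Complex.exp (m * (x + y * Complex.I))
        = (a n * Complex.exp ((m - n) * x)) *
          Complex.exp (((m - n : ℤ) : ℂ) * Complex.I * y) := by
      intro y
      rw [mul_assoc, mul_assoc, ← Complex.exp_add, ← Complex.exp_add]
      push_cast
      ring_nf
    simp_rw [this]
    rw [intervalIntegral.integral_const_mul, integral_exp_int_mul_I]
    by_cases h : n = m
    · subst h; simp; ring
    · rw [if_neg h, if_neg (by omega), mul_zero]
  simp_rw [hterm] at key
  exact key.unique (hasSum_ite_eq m _)

/-- Asymptotics of the coefficients of a series that grows like `g(Re s) e^{A / s}` near `0`. -/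
theorem tendsto_coeff {a : ℕ → ℝ} {g : ℝ → ℝ} {h : ℝ → ℝ → ℂ} {A B K δ x₀ : ℝ}
    (hA : 0 < A) (hK : 0 < K) (hδ : 0 < δ) (hx₀ : 0 < x₀)
    (ha : ∀ x : ℝ, 0 < x → Summable fun n : ℕ => |a n| * Real.exp (-(n * x)))
    (hg : ∀ x, 0 < x → 0 < g x)
    (hmaj : ∀ x, 0 < x → x < x₀ → ∀ u, |u| ≤ K →
      expSeries a (x * (1 + u * Complex.I))
        = g x * Complex.exp (A / (x * (1 + u * Complex.I))) * h x u)
    (hB : ∀ x, 0 < x → x < x₀ → ∀ u, |u| ≤ K → ‖h x u‖ ≤ B)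
    (hlim : Tendsto (fun z : ℝ × ℝ => h z.1 z.2) (𝓝[>] 0 ×ˢ 𝓝 0) (𝓝 1))
    (hmin : ∀ x, 0 < x → x < x₀ → ∀ y, K * x ≤ |y| → |y| ≤ Real.pi →
      ‖expSeries a (x + y * Complex.I)‖ ≤ g x * (B * Real.exp ((A - δ) / x))) :
    Tendsto (fun n : ℕ => a n / (g (A / √(A * n)) * Real.exp (2 * √(A * n)) *
      (A / √(A * n) / √√(A * n)))) atTop (𝓝 (√Real.pi / (2 * Real.pi))) := by
  have hM : Tendsto (fun n : ℕ => √(A * n)) atTop atTop :=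
    Real.tendsto_sqrt_atTop.comp (tendsto_natCast_atTop_atTop.const_mul_atTop hA)
  have key := (tendsto_saddle_point hA hK hδ hx₀
    (fun x hx => continuous_expSeries_vertical (ha x hx)) hg hmaj hB hlim hmin).comp hM
  have key' := ((Complex.continuous_re.tendsto _).comp key).div_const (2 * Real.pi)
  rw [Complex.ofReal_re] at key'
  refine key'.congr' ?_
  filter_upwards [eventually_gt_atTop 0] with n hn
  have hn' : (0 : ℝ) < A * n := by positivity
  have e : √(A * n) / (A / √(A * n)) = n := by
    rw [div_div_eq_mul_div, Real.mul_self_sqrt hn'.le]; field_simp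
  simp only [Function.comp_apply]
  rw [e, Complex.ofReal_natCast, integral_expSeries_mul_exp (ha _ (by positivity))]
  rw [show (2 * Real.pi * a n : ℂ) = ((2 * Real.pi * a n : ℝ) : ℂ) by push_cast; ring,
    ← Complex.ofReal_div, Complex.ofReal_re]
  field_simp

end PartitionAsymptotics

namespace PartitionAsymptotics

open Topology PowerSeries PowerSeries.WithPiTopology

/-- Absolutely convergent power series evaluate multiplicatively. -/
lemma summable_tsum_coeff_mul {f g : ℝ⟦X⟧} {w : ℂ}
    (hf : Summable fun n => ‖((coeff n f : ℝ) : ℂ) * w ^ n‖)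
    (hg : Summable fun n => ‖((coeff n g : ℝ) : ℂ) * w ^ n‖) :
    (Summable fun n => ‖((coeff n (f * g) : ℝ) : ℂ) * w ^ n‖) ∧
      ∑' n, ((coeff n (f * g) : ℝ) : ℂ) * w ^ n =
        (∑' n, ((coeff n f : ℝ) : ℂ) * w ^ n) * ∑' n, ((coeff n g : ℝ) : ℂ) * w ^ n := by
  have e : ∀ n, ((coeff n (f * g) : ℝ) : ℂ) * w ^ n = ∑ kl ∈ Finset.HasAntidiagonal.antidiagonal n,
      (((coeff kl.1 f : ℝ) : ℂ) * w ^ kl.1) * (((coeff kl.2 g : ℝ) : ℂ) * w ^ kl.2) := by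
    intro n
    rw [PowerSeries.coeff_mul]
    push_cast
    rw [Finset.sum_mul]
    refine Finset.sum_congr rfl fun kl hkl => ?_
    rw [← Finset.HasAntidiagonal.mem_antidiagonal.1 hkl, pow_add]
    ring
  simp_rw [e]
  generalize ha : (fun n => ((coeff n f : ℝ) : ℂ) * w ^ n) = a at hf
  generalize hb : (fun n => ((coeff n g : ℝ) : ℂ) * w ^ n) = b at hg
  have ha' : ∀ n, ((coeff n f : ℝ) : ℂ) * w ^ n = a n := fun n => congrFun ha n
  have hb' : ∀ n, ((coeff n g : ℝ) : ℂ) * w ^ n = b n := fun n => congrFun hb n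
  simp only [ha', hb'] at hf hg ⊢
  exact ⟨summable_norm_sum_mul_antidiagonal_of_summable_norm hf hg,
    (tsum_mul_tsum_eq_tsum_sum_antidiagonal_of_summable_norm hf hg).symm⟩

lemma summable_tsum_coeff_prod {f : ℕ → ℝ⟦X⟧} {φ : ℕ → ℂ} {w : ℂ}
    (hs : ∀ i, Summable fun n => ‖((coeff n (f i) : ℝ) : ℂ) * w ^ n‖)
    (hφ : ∀ i, ∑' n, ((coeff n (f i) : ℝ) : ℂ) * w ^ n = φ i) (N : ℕ) :
    (Summable fun n => ‖((coeff n (∏ i ∈ Finset.range N, f i) : ℝ) : ℂ) * w ^ n‖) ∧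
      ∑' n, ((coeff n (∏ i ∈ Finset.range N, f i) : ℝ) : ℂ) * w ^ n =
        ∏ i ∈ Finset.range N, φ i := by
  induction N with
  | zero =>
    have e : ∀ n : ℕ, ((coeff n (1 : ℝ⟦X⟧) : ℝ) : ℂ) * w ^ n = if n = 0 then 1 else 0 := by
      intro n
      rw [PowerSeries.coeff_one]
      split_ifs with h <;> simp [h]
    simp only [Finset.range_zero, Finset.prod_empty, e]
    refine ⟨?_, tsum_ite_eq 0 _⟩
    refine summable_of_ne_finset_zero (s := {0}) fun b hb => ?_
    rw [if_neg (by simpa using hb), norm_zero]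
  | succ N ih =>
    rw [Finset.prod_range_succ, Finset.prod_range_succ, ← ih.2, ← hφ N]
    exact summable_tsum_coeff_mul ih.1 (hs N)

lemma coeff_mul_mono_nonneg {f g : ℝ⟦X⟧} (hf : ∀ n, 0 ≤ coeff n f) (hg : ∀ n, 0 ≤ coeff n g)
    (hg1 : 1 ≤ coeff 0 g) (n : ℕ) : coeff n f ≤ coeff n (f * g) := by
  rw [PowerSeries.coeff_mul]
  calc coeff n f ≤ coeff n f * coeff 0 g := le_mul_of_one_le_right (hf n) hg1
    _ ≤ _ := Finset.single_le_sum (f := fun kl : ℕ × ℕ => coeff kl.1 f * coeff kl.2 g)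
      (fun kl _ => mul_nonneg (hf _) (hg _)) (by simp : (n, 0) ∈ Finset.HasAntidiagonal.antidiagonal n)

/-- Evaluation of an infinite product of power series with nonnegative coefficients. -/
theorem tendsto_prod_eval {f : ℕ → ℝ⟦X⟧} {F : ℝ⟦X⟧} (hF : HasProd f F)
    (hf0 : ∀ i n, 0 ≤ coeff n (f i)) (hf1 : ∀ i, 1 ≤ coeff 0 (f i))
    {φ : ℂ → ℕ → ℂ} (hs : ∀ w : ℂ, ‖w‖ < 1 → ∀ i,
      (Summable fun n => ‖((coeff n (f i) : ℝ) : ℂ) * w ^ n‖) ∧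
        ∑' n, ((coeff n (f i) : ℝ) : ℂ) * w ^ n = φ w i)
    (hφ : ∀ w : ℂ, ‖w‖ < 1 → ∃ l, Tendsto (fun N => ∏ i ∈ Finset.range N, φ w i) atTop (𝓝 l))
    {w : ℂ} (hw : ‖w‖ < 1) :
    (∀ n, 0 ≤ coeff n F) ∧ (Summable fun n => coeff n F * ‖w‖ ^ n) ∧
    Tendsto (fun N => ∏ i ∈ Finset.range N, φ w i) atTop
      (𝓝 (∑' n, ((coeff n F : ℝ) : ℂ) * w ^ n)) := by
  set S : ℕ → ℝ⟦X⟧ := fun N => ∏ i ∈ Finset.range N, f i with hS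
  have hS0 : ∀ N n, 0 ≤ coeff n (S N) := by
    intro N
    induction N with
    | zero => intro n; simp only [hS, Finset.range_zero, Finset.prod_empty, PowerSeries.coeff_one]
              split_ifs <;> norm_num
    | succ N ih =>
      intro n
      simp only [hS, Finset.prod_range_succ, PowerSeries.coeff_mul]
      exact Finset.sum_nonneg fun kl _ => mul_nonneg (ih _) (hf0 _ _)
  have hmono : ∀ n, Monotone fun N => coeff n (S N) := by
    intro n
    refine monotone_nat_of_le_succ fun N => ?_
    simp only [hS, Finset.prod_range_succ]
    exact coeff_mul_mono_nonneg (hS0 N) (hf0 N) (hf1 N) n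
  have hlim : ∀ n, Tendsto (fun N => coeff n (S N)) atTop (𝓝 (coeff n F)) :=
    (tendsto_iff_coeff_tendsto ℝ _ _ _).1 hF.tendsto_prod_nat
  have hle : ∀ N n, coeff n (S N) ≤ coeff n F := fun N n => (hmono n).ge_of_tendsto (hlim n) N
  have hF0 : ∀ n, 0 ≤ coeff n F := fun n => (hS0 0 n).trans (hle 0 n)
  have hr : ‖((‖w‖ : ℝ) : ℂ)‖ < 1 := by simpa using hw
  have hsum : Summable fun n => coeff n F * ‖w‖ ^ n := by
    obtain ⟨l, hl⟩ := hφ _ hr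
    obtain ⟨B, hB⟩ := hl.norm.bddAbove_range
    refine summable_of_sum_range_le (c := B) (fun n => mul_nonneg (hF0 n) (by positivity))
      fun k => ?_
    refine le_of_tendsto (tendsto_finsetSum (Finset.range k)
      fun n _ => (hlim n).mul_const (‖w‖ ^ n)) (Eventually.of_forall fun N => ?_)
    obtain ⟨h1, h2⟩ := summable_tsum_coeff_prod (fun i => (hs _ hr i).1) (fun i => (hs _ hr i).2) N
    have e : ∀ n, ‖((coeff n (S N) : ℝ) : ℂ) * ((‖w‖ : ℝ) : ℂ) ^ n‖ = coeff n (S N) * ‖w‖ ^ n := by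
      intro n
      simp [abs_of_nonneg (hS0 N n)]
    have e' : ∀ n, ((coeff n (S N) : ℝ) : ℂ) * ((‖w‖ : ℝ) : ℂ) ^ n
        = ((coeff n (S N) * ‖w‖ ^ n : ℝ) : ℂ) := by
      intro n
      push_cast; rfl
    change Summable (fun n => ‖((coeff n (S N) : ℝ) : ℂ) * ((‖w‖ : ℝ) : ℂ) ^ n‖) at h1
    change ∑' n, ((coeff n (S N) : ℝ) : ℂ) * ((‖w‖ : ℝ) : ℂ) ^ n = _ at h2
    simp_rw [e] at h1
    simp_rw [e'] at h2
    rw [← Complex.ofReal_tsum] at h2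
    calc _ ≤ ∑' n, coeff n (S N) * ‖w‖ ^ n :=
          h1.sum_le_tsum _ fun n _ => mul_nonneg (hS0 N n) (by positivity)
      _ ≤ ‖((∑' n, coeff n (S N) * ‖w‖ ^ n : ℝ) : ℂ)‖ := by
          rw [Complex.norm_real]; exact le_abs_self _
      _ ≤ B := by rw [h2]; exact hB ⟨N, rfl⟩
  refine ⟨hF0, hsum, ?_⟩
  have hdom := tendsto_tsum_of_dominated_convergence (𝓕 := atTop)
    (f := fun N n => ((coeff n (S N) : ℝ) : ℂ) * w ^ n)
    (g := fun n => ((coeff n F : ℝ) : ℂ) * w ^ n) hsum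
    (fun n => ((Complex.continuous_ofReal.tendsto _).comp (hlim n)).mul_const _)
    (Eventually.of_forall fun N n => by
      rw [norm_mul, norm_pow, Complex.norm_real, Real.norm_of_nonneg (hS0 N n)]
      exact mul_le_mul_of_nonneg_right (hle N n) (by positivity))
  refine hdom.congr fun N => ?_
  exact (summable_tsum_coeff_prod (fun i => (hs _ hw i).1) (fun i => (hs _ hw i).2) N).2

/-- The Euler function `∏ (1 - w ^ n)`. -/
noncomputable def eulerPhi (w : ℂ) : ℂ := ∏' n : ℕ, (1 - w ^ (n + 1))

lemma tendsto_eulerPhi_partial {w : ℂ} (hw : ‖w‖ < 1) :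
    Tendsto (fun N => ∏ i ∈ Finset.range N, (1 - w ^ (i + 1))) atTop (𝓝 (eulerPhi w)) :=
  (ModularForm.multipliable_one_sub_pow hw).hasProd.tendsto_prod_nat

lemma one_sub_pow_ne_zero {w : ℂ} (hw : ‖w‖ < 1) (i : ℕ) : 1 - w ^ (i + 1) ≠ 0 := by
  intro h
  have h1 : ‖w ^ (i + 1)‖ = 1 := by rw [← sub_eq_zero.1 h, norm_one]
  rw [norm_pow] at h1
  exact (pow_lt_one₀ (norm_nonneg _) hw (Nat.succ_ne_zero i)).ne h1

lemma eulerPhi_ne_zero {w : ℂ} (hw : ‖w‖ < 1) : eulerPhi w ≠ 0 := by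
  have hs := (summable_nat_add_iff 1).mpr (summable_geometric_of_lt_one (norm_nonneg _) hw)
  have := tprod_one_add_ne_zero_of_summable (f := fun n : ℕ => -w ^ (n + 1))
    (fun i => by simpa [← sub_eq_add_neg] using one_sub_pow_ne_zero hw i) (by simpa using hs)
  simpa [eulerPhi, sub_eq_add_neg] using this

lemma tendsto_eulerPhi_zero : Tendsto eulerPhi (𝓝 0) (𝓝 1) := by
  have h := (ModularForm.differentiableOn_tprod_one_sub_pow.differentiableAt
    (Metric.ball_mem_nhds 0 one_pos)).continuousAt.tendsto
  have h0 : eulerPhi 0 = 1 := by simp [eulerPhi]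
  rw [← h0]
  exact h

lemma coeff_tsum_X_pow (i n : ℕ) :
    coeff n (∑' j : ℕ, (X : ℝ⟦X⟧) ^ ((i + 1) * j)) = if (i + 1) ∣ n then 1 else 0 := by
  have h : HasSum (fun j : ℕ => (X : ℝ⟦X⟧) ^ ((i + 1) * j))
      (PowerSeries.mk fun n => if (i + 1) ∣ n then (1 : ℝ) else 0) := by
    rw [hasSum_iff_hasSum_coeff]
    intro d
    simp only [coeff_X_pow, coeff_mk]
    split_ifs with hd
    · obtain ⟨k, rfl⟩ := hd
      refine (hasSum_ite_eq k (1 : ℝ)).congr_fun fun j => ?_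
      simp [eq_comm]
    · refine hasSum_zero.congr_fun fun j => ?_
      rw [if_neg]
      rintro rfl
      exact hd (dvd_mul_right _ _)
  rw [h.tsum_eq, coeff_mk]

lemma hasSum_dvd_pow {w : ℂ} (hw : ‖w‖ < 1) (i : ℕ) :
    HasSum (fun n : ℕ => (((if (i + 1) ∣ n then 1 else 0 : ℝ)) : ℂ) * w ^ n)
      (1 - w ^ (i + 1))⁻¹ := by
  have h1 : ‖w ^ (i + 1)‖ < 1 := by
    rw [norm_pow]; exact pow_lt_one₀ (norm_nonneg _) hw (Nat.succ_ne_zero i)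
  have hinj : Function.Injective fun j : ℕ => (i + 1) * j :=
    mul_right_injective₀ (Nat.succ_ne_zero i)
  rw [← hinj.hasSum_iff]
  · refine (hasSum_geometric_of_norm_lt_one h1).congr_fun fun j => ?_
    simp only [Function.comp_apply]
    rw [if_pos (dvd_mul_right _ _), pow_mul, Complex.ofReal_one, one_mul]
  · intro n hn
    rw [if_neg]
    · simp
    · rintro ⟨k, rfl⟩
      exact hn ⟨k, rfl⟩

lemma hasProd_p : HasProd (fun i : ℕ => ∑' j : ℕ, (X : ℝ⟦X⟧) ^ ((i + 1) * j))
    (PowerSeries.mk fun n => (p n : ℝ)) := by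
  have h := Nat.Partition.hasProd_powerSeriesMk_card_restricted ℝ (fun _ => True)
  simpa [Nat.Partition.restricted, p] using h

lemma hasProd_q : HasProd (fun i : ℕ => (1 + X ^ (i + 1) : ℝ⟦X⟧))
    (PowerSeries.mk fun n => (q n : ℝ)) := by
  have h := Nat.Partition.hasProd_powerSeriesMk_card_countRestricted ℝ two_pos
  simp only [Nat.Partition.countRestricted_two] at h
  refine h.congr_fun fun i => ?_
  exact ((Finset.sum_range_succ _ 1).trans (by simp)).symm

lemma p_genFun {w : ℂ} (hw : ‖w‖ < 1) :
    (Summable fun n => (p n : ℝ) * ‖w‖ ^ n) ∧ ∑' n, (p n : ℂ) * w ^ n = (eulerPhi w)⁻¹ := by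
  have hlim : ∀ w : ℂ, ‖w‖ < 1 → Tendsto (fun N => ∏ i ∈ Finset.range N, (1 - w ^ (i + 1))⁻¹)
      atTop (𝓝 (eulerPhi w)⁻¹) := by
    intro w hw
    simp_rw [Finset.prod_inv_distrib]
    exact (tendsto_eulerPhi_partial hw).inv₀ (eulerPhi_ne_zero hw)
  obtain ⟨-, h2, h3⟩ := tendsto_prod_eval hasProd_p
    (fun i n => by rw [coeff_tsum_X_pow]; split_ifs <;> norm_num)
    (fun i => by rw [coeff_tsum_X_pow]; simp)
    (φ := fun w i => (1 - w ^ (i + 1))⁻¹)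
    (fun w hw i => by
      simp_rw [coeff_tsum_X_pow]
      exact ⟨(hasSum_dvd_pow hw i).summable.norm, (hasSum_dvd_pow hw i).tsum_eq⟩)
    (fun w hw => ⟨_, hlim w hw⟩) hw
  simp only [coeff_mk, Complex.ofReal_natCast] at h2 h3
  exact ⟨h2, tendsto_nhds_unique h3 (hlim w hw)⟩

lemma norm_sq_lt_one {w : ℂ} (hw : ‖w‖ < 1) : ‖w ^ 2‖ < 1 := by
  rw [norm_pow]; exact pow_lt_one₀ (norm_nonneg _) hw two_ne_zero

lemma tendsto_prod_one_add_pow {w : ℂ} (hw : ‖w‖ < 1) :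
    Tendsto (fun N => ∏ i ∈ Finset.range N, (1 + w ^ (i + 1))) atTop
      (𝓝 (eulerPhi (w ^ 2) / eulerPhi w)) := by
  refine ((tendsto_eulerPhi_partial (norm_sq_lt_one hw)).div (tendsto_eulerPhi_partial hw)
    (eulerPhi_ne_zero hw)).congr fun N => ?_
  simp only [Pi.div_apply]
  rw [← Finset.prod_div_distrib]
  refine Finset.prod_congr rfl fun i _ => ?_
  rw [div_eq_iff (one_sub_pow_ne_zero hw i)]
  ring

lemma q_genFun {w : ℂ} (hw : ‖w‖ < 1) :
    (Summable fun n => (q n : ℝ) * ‖w‖ ^ n) ∧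
      ∑' n, (q n : ℂ) * w ^ n = eulerPhi (w ^ 2) / eulerPhi w := by
  have hco : ∀ i n, coeff n (1 + X ^ (i + 1) : ℝ⟦X⟧)
      = (if n = 0 then 1 else 0) + if n = i + 1 then 1 else 0 := by
    intro i n
    rw [map_add, coeff_one, coeff_X_pow]
  obtain ⟨-, h2, h3⟩ := tendsto_prod_eval hasProd_q
    (fun i n => by rw [hco]; split_ifs <;> norm_num)
    (fun i => by rw [hco]; simp)
    (φ := fun w i => 1 + w ^ (i + 1))
    (fun w hw i => by
      have h : HasSum (fun n => ((coeff n (1 + X ^ (i + 1) : ℝ⟦X⟧) : ℝ) : ℂ) * w ^ n)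
          (1 + w ^ (i + 1)) := by
        convert (hasSum_ite_eq 0 (1 : ℂ)).add (hasSum_ite_eq (i + 1) (w ^ (i + 1))) using 2 with n
        rw [hco]
        split_ifs with ha hb hb <;> simp_all
      exact ⟨h.summable.norm, h.tsum_eq⟩)
    (fun w hw => ⟨_, tendsto_prod_one_add_pow hw⟩) hw
  simp only [coeff_mk, Complex.ofReal_natCast] at h2 h3
  exact ⟨h2, tendsto_nhds_unique h3 (tendsto_prod_one_add_pow hw)⟩

lemma norm_one_add_le (w : ℂ) (hw : ‖w‖ < 1) :
    ‖1 + w‖ ≤ (1 + ‖w‖) * Real.exp (-((‖w‖ - w.re) / 4)) := by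
  refine abs_le_of_sq_le_sq' ?_ (by positivity) |>.2
  have h0 : 0 ≤ ‖w‖ - w.re := sub_nonneg.2 (Complex.re_le_norm w)
  have h1 : ‖1 + w‖ ^ 2 = (1 + ‖w‖) ^ 2 - 2 * (‖w‖ - w.re) := by
    have e : ‖w‖ ^ 2 = w.re * w.re + w.im * w.im := by
      rw [← Complex.normSq_eq_norm_sq, Complex.normSq_apply]
    rw [← Complex.normSq_eq_norm_sq, Complex.normSq_apply]
    simp
    linarith
  have h2 := Real.add_one_le_exp (-((‖w‖ - w.re) / 2))
  have h3 : (1 + ‖w‖) ^ 2 ≤ 4 := by nlinarith [norm_nonneg w]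
  rw [h1, mul_pow, ← Real.exp_nat_mul, show ((2 : ℕ) : ℝ) * -((‖w‖ - w.re) / 4)
    = -((‖w‖ - w.re) / 2) by push_cast; ring]
  calc (1 + ‖w‖) ^ 2 - 2 * (‖w‖ - w.re) ≤ (1 + ‖w‖) ^ 2 * (-((‖w‖ - w.re) / 2) + 1) := by
        nlinarith
    _ ≤ _ := by gcongr

/-- The generating function of partitions into distinct parts decays away from the positive
real axis. -/
lemma norm_q_genFun_le {w : ℂ} (hw : ‖w‖ < 1) :
    ‖eulerPhi (w ^ 2) / eulerPhi w‖ ≤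
      ‖eulerPhi ((‖w‖ : ℂ) ^ 2) / eulerPhi ‖w‖‖ *
        Real.exp (-((‖w‖ / (1 - ‖w‖) - (w / (1 - w)).re) / 4)) := by
  have hr : ‖(‖w‖ : ℂ)‖ < 1 := by simpa using hw
  have hgeo : Tendsto (fun N => ∑ i ∈ Finset.range N, (‖w‖ ^ (i + 1) - (w ^ (i + 1)).re)) atTop
      (𝓝 (‖w‖ / (1 - ‖w‖) - (w / (1 - w)).re)) := by
    have h1 := (hasSum_geometric_of_lt_one (norm_nonneg w) hw).mul_left ‖w‖
    have h2 := Complex.hasSum_re ((hasSum_geometric_of_norm_lt_one hw).mul_left w)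
    simpa [pow_succ', div_eq_mul_inv] using (h1.sub h2).tendsto_sum_nat
  have hexp := (Real.continuous_exp.tendsto _).comp ((hgeo.div_const 4).neg)
  refine le_of_tendsto_of_tendsto' (tendsto_prod_one_add_pow hw).norm
    ((tendsto_prod_one_add_pow hr).norm.mul hexp) fun N => ?_
  simp only [Function.comp_apply]
  rw [Finset.sum_div, ← Finset.sum_neg_distrib, Real.exp_sum, norm_prod, norm_prod,
    ← Finset.prod_mul_distrib]
  refine Finset.prod_le_prod (fun i _ => norm_nonneg _) fun i _ => ?_
  have h1 : ‖w ^ (i + 1)‖ < 1 := by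
    rw [norm_pow]; exact pow_lt_one₀ (norm_nonneg _) hw (Nat.succ_ne_zero i)
  have h2 : ‖1 + (‖w‖ : ℂ) ^ (i + 1)‖ = 1 + ‖w‖ ^ (i + 1) := by
    rw [show 1 + (‖w‖ : ℂ) ^ (i + 1) = ((1 + ‖w‖ ^ (i + 1) : ℝ) : ℂ) by push_cast; rfl,
      Complex.norm_real, Real.norm_of_nonneg (by positivity)]
  have := norm_one_add_le _ h1
  rwa [norm_pow, ← h2] at this

lemma norm_p_genFun_le {w : ℂ} (hw : ‖w‖ < 1) :
    ‖(eulerPhi w)⁻¹‖ ≤ ‖(eulerPhi ‖w‖)⁻¹‖ *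
        Real.exp (-((‖w‖ / (1 - ‖w‖) - (w / (1 - w)).re) / 4)) := by
  have hr : ‖(‖w‖ : ℂ)‖ < 1 := by simpa using hw
  have e : ∀ z : ℂ, ‖z‖ < 1 →
      ‖(eulerPhi z)⁻¹‖ = ‖eulerPhi (z ^ 2) / eulerPhi z‖ * ‖(eulerPhi (z ^ 2))⁻¹‖ := by
    intro z hz
    have := eulerPhi_ne_zero (norm_sq_lt_one hz)
    rw [← norm_mul]
    congr 1
    field_simp
  have hsq : ‖(eulerPhi (w ^ 2))⁻¹‖ ≤ ‖(eulerPhi ((‖w‖ : ℂ) ^ 2))⁻¹‖ := by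
    obtain ⟨h1, h2⟩ := p_genFun (norm_sq_lt_one hw)
    obtain ⟨-, h3⟩ := p_genFun (norm_sq_lt_one hr)
    rw [← h2, ← h3]
    have h4 : ∑' n, (p n : ℂ) * ((‖w‖ : ℂ) ^ 2) ^ n = ((∑' n, (p n : ℝ) * ‖w ^ 2‖ ^ n : ℝ) : ℂ) := by
      rw [Complex.ofReal_tsum]; push_cast; simp
    rw [h4, Complex.norm_real]
    refine (norm_tsum_le_tsum_norm (by simpa using h1)).trans ((le_of_eq ?_).trans (le_abs_self _))
    simp
  rw [e w hw, e _ hr]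
  calc _ ≤ _ := mul_le_mul (norm_q_genFun_le hw) hsq (norm_nonneg _) (by positivity)
    _ = _ := by ring

/-- Lower bound for the exponential saving on the minor arcs. -/
lemma minor_arc_saving {x y : ℝ} (hx : 0 < x) (hx4 : x < 1 / 4) (hy : Real.pi * x ≤ |y|)
    (hy' : |y| ≤ Real.pi) {w : ℂ} (hw : w = Complex.exp (-(x + y * Complex.I))) :
    1 / (4 * x) ≤ ‖w‖ / (1 - ‖w‖) - (w / (1 - w)).re := by
  have hr : ‖w‖ = Real.exp (-x) := by rw [hw, Complex.norm_exp]; simp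
  have hre : w.re = Real.exp (-x) * Real.cos y := by
    rw [hw, Complex.exp_re]; simp
  have hr1 : ‖w‖ < 1 := by rw [hr, Real.exp_lt_one_iff]; linarith
  have hlow : 1 - x ≤ ‖w‖ := by rw [hr]; linarith [Real.add_one_le_exp (-x)]
  have hcos := Real.cos_le_one_sub_mul_cos_sq hy'
  have hsq : ‖1 - w‖ ^ 2 = 1 - 2 * (‖w‖ * Real.cos y) + ‖w‖ ^ 2 := by
    have e : ‖w‖ ^ 2 = w.re * w.re + w.im * w.im := by
      rw [← Complex.normSq_eq_norm_sq, Complex.normSq_apply]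
    rw [← Complex.normSq_eq_norm_sq, Complex.normSq_apply, hr, ← hre, ← hr, e]
    simp
    ring
  have hyx : Real.pi ^ 2 * x ^ 2 ≤ y ^ 2 := by
    rw [← mul_pow, ← sq_abs y]
    gcongr
  have hyx' : 2 * x ^ 2 ≤ 2 / Real.pi ^ 2 * y ^ 2 := by
    rw [div_mul_eq_mul_div, le_div_iff₀ (by positivity)]
    linarith
  have hw0 : 0 < ‖w‖ := by linarith
  have hden : 2 * x * ‖w‖ ≤ ‖1 - w‖ := by
    refine abs_le_of_sq_le_sq' ?_ (norm_nonneg _) |>.2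
    have h1 : ‖w‖ * Real.cos y ≤ ‖w‖ * (1 - 2 * x ^ 2) := by gcongr; linarith
    have h2 : ‖w‖ ^ 2 * x ^ 2 ≤ ‖w‖ * x ^ 2 := by
      gcongr
      nlinarith
    nlinarith [sq_nonneg (1 - ‖w‖)]
  have hupper : (w / (1 - w)).re ≤ 1 / (2 * x) := by
    refine (Complex.re_le_norm _).trans ?_
    rw [norm_div, div_le_div_iff₀ (lt_of_lt_of_le (by positivity) hden) (by positivity)]
    linarith
  have hlower : (3 / 4) / x ≤ ‖w‖ / (1 - ‖w‖) := by
    rw [div_le_div_iff₀ hx (by linarith)]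
    nlinarith
  have e : 1 / (4 * x) = (3 / 4) / x - 1 / (2 * x) := by
    field_simp
    norm_num
  linarith

end PartitionAsymptotics

namespace PartitionAsymptotics

open Topology

lemma csqrt_mul {x y : ℂ} (hx : x ≠ 0) (hy : y ≠ 0)
    (h : x.arg + y.arg ∈ Set.Ioc (-Real.pi) Real.pi) :
    Complex.sqrt (x * y) = Complex.sqrt x * Complex.sqrt y := by
  rw [Complex.sqrt, Complex.sqrt, Complex.sqrt, Complex.cpow_def_of_ne_zero (mul_ne_zero hx hy),
    Complex.cpow_def_of_ne_zero hx, Complex.cpow_def_of_ne_zero hy, ← Complex.exp_add,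
    Complex.log_mul hx hy h, add_mul]

lemma csqrt_I_mul {s : ℂ} (hs : 0 < s.re) :
    Complex.sqrt (Complex.I * s) = Complex.sqrt Complex.I * Complex.sqrt s := by
  have hs0 : s ≠ 0 := by rintro rfl; simp at hs
  have h := abs_lt.1 (Complex.abs_arg_lt_pi_div_two_iff.2 (Or.inl hs))
  refine csqrt_mul Complex.I_ne_zero hs0 ?_
  rw [Complex.arg_I]
  constructor <;> linarith [h.1, h.2, Real.pi_pos]

lemma csqrt_ofReal_mul {r : ℝ} (hr : 0 < r) {z : ℂ} (hz : z ≠ 0) :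
    Complex.sqrt (r * z) = (√r : ℝ) * Complex.sqrt z := by
  rw [csqrt_mul (Complex.ofReal_ne_zero.2 hr.ne') hz]
  · rw [Complex.sqrt, Real.sqrt_eq_rpow, Complex.ofReal_cpow hr.le]
    norm_num
  · rw [Complex.arg_ofReal_of_nonneg hr.le, zero_add]
    exact Complex.arg_mem_Ioc z

lemma eta_eq_eulerPhi {z w : ℂ} (h : 2 * Real.pi * Complex.I * z = w) :
    ModularForm.eta z = Complex.exp (w / 24) * eulerPhi (Complex.exp w) := by
  rw [ModularForm.eta, eulerPhi]
  simp_rw [ModularForm.eta_q_eq_pow, h]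
  rw [Function.Periodic.qParam, h]
  norm_num

lemma norm_cexp_neg_lt_one {s : ℂ} (hs : 0 < s.re) : ‖Complex.exp (-s)‖ < 1 := by
  rw [Complex.norm_exp, Complex.neg_re]
  exact Real.exp_lt_one_iff.2 (neg_lt_zero.2 hs)

lemma re_ofReal_div_pos {a : ℝ} (ha : 0 < a) {s : ℂ} (hs : 0 < s.re) : 0 < ((a : ℂ) / s).re := by
  rw [div_eq_mul_inv, Complex.re_ofReal_mul, Complex.inv_re]
  have : s ≠ 0 := by rintro rfl; simp at hs
  have := Complex.normSq_pos.2 this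
  positivity

/-- The modular transformation of the Euler product, in the form
`1 / φ(e^{-s}) = √(s / 2π) e^{-s/24} e^{π²/(6s)} / φ(e^{-4π²/s})`. -/
lemma eulerPhi_inv_eq {s : ℂ} (hs : 0 < s.re) :
    (eulerPhi (Complex.exp (-s)))⁻¹ = Complex.sqrt (s / (2 * Real.pi)) * Complex.exp (-s / 24) *
      Complex.exp ((Real.pi ^ 2 / 6 : ℝ) / s) *
        (eulerPhi (Complex.exp (-((4 * Real.pi ^ 2 : ℝ) / s))))⁻¹ := by
  have hs0 : s ≠ 0 := by rintro rfl; simp at hs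
  have hpi : (Real.pi : ℂ) ≠ 0 := Complex.ofReal_ne_zero.2 Real.pi_ne_zero
  have hre : 0 < (s / (2 * Real.pi)).re := by
    have : s / (2 * Real.pi) = ((1 / (2 * Real.pi) : ℝ) : ℂ) * s := by push_cast; ring
    rw [this, Complex.re_ofReal_mul]
    have := Real.pi_pos
    positivity
  have hz : Complex.I * (s / (2 * Real.pi)) ∈ UpperHalfPlane.upperHalfPlaneSet := by
    simpa [UpperHalfPlane.upperHalfPlaneSet] using hre
  have h := ModularForm.eta_comp_eq_csqrt_I_inv hz
  simp only [Function.comp_apply, Pi.smul_apply, Pi.mul_apply, smul_eq_mul] at h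
  rw [eta_eq_eulerPhi (w := -s) (z := Complex.I * (s / (2 * Real.pi))),
    eta_eq_eulerPhi (w := -((4 * Real.pi ^ 2 : ℝ) / s)), csqrt_I_mul hre] at h
  · have hI : Complex.sqrt Complex.I ≠ 0 := by simp [Complex.sqrt]
    rw [mul_assoc, inv_mul_cancel_left₀ hI] at h
    have h1 := eulerPhi_ne_zero (norm_cexp_neg_lt_one hs)
    have h2 := eulerPhi_ne_zero (norm_cexp_neg_lt_one
      (re_ofReal_div_pos (by have := Real.pi_pos; positivity : 0 < 4 * Real.pi ^ 2) hs))
    have h3 : Complex.exp ((Real.pi ^ 2 / 6 : ℝ) / s) =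
        (Complex.exp (-((4 * Real.pi ^ 2 : ℝ) / s) / 24))⁻¹ := by
      rw [← Complex.exp_neg]
      congr 1
      push_cast
      ring
    have h4 := Complex.exp_ne_zero (-((4 * Real.pi ^ 2 : ℝ) / s) / 24)
    rw [h3]
    generalize Complex.exp (-((4 * Real.pi ^ 2 : ℝ) / s) / 24) = E at h h4 ⊢
    generalize Complex.exp (-s / 24) = F at h ⊢
    field_simp
    linear_combination h
  · push_cast
    field_simp
    ring_nf
  · field_simp
    exact Complex.I_sq

/-- `φ(e^{-a/s}) → 1` as `s = x (1 + u i)` tends to zero inside a fixed sector. -/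
lemma eventually_norm_eulerPhi_sub_one_lt {a K ε : ℝ} (ha : 0 < a) (hε : 0 < ε) :
    ∃ x₀ : ℝ, 0 < x₀ ∧ ∀ x : ℝ, 0 < x → x < x₀ → ∀ u : ℝ, |u| ≤ K →
      ‖eulerPhi (Complex.exp (-(a / (x * (1 + u * Complex.I))))) - 1‖ < ε := by
  obtain ⟨η, hη, h⟩ := Metric.tendsto_nhds_nhds.1 tendsto_eulerPhi_zero ε hε
  have hlim : Tendsto (fun x : ℝ => Real.exp (-(a / (1 + K ^ 2) * x⁻¹))) (𝓝[>] 0) (𝓝 0) := by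
    refine Real.tendsto_exp_neg_atTop_nhds_zero.comp ?_
    exact tendsto_inv_nhdsGT_zero.const_mul_atTop (by positivity)
  obtain ⟨x₀, hx₀, hx⟩ := (nhdsGT_basis (0 : ℝ)).eventually_iff.1
    (hlim.eventually_lt_const hη)
  refine ⟨x₀, hx₀, fun x h0 h1 u hu => ?_⟩
  rw [← dist_eq_norm]
  refine h ?_
  rw [dist_zero_right, Complex.norm_exp]
  refine lt_of_le_of_lt ?_ (hx ⟨h0, h1⟩)
  rw [Real.exp_le_exp, Complex.neg_re, neg_le_neg_iff, ← div_div, ← Complex.ofReal_div,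
    re_real_div_one_add_mul_I]
  have hu2 : u ^ 2 ≤ K ^ 2 := sq_le_sq.2 (hu.trans (le_abs_self K))
  rw [← div_eq_mul_inv, div_div, mul_comm, ← div_div]
  gcongr

lemma expSeries_eq_tsum_pow (a : ℕ → ℕ) (s : ℂ) :
    expSeries (fun n => (a n : ℝ)) s = ∑' n, (a n : ℂ) * Complex.exp (-s) ^ n := by
  rw [expSeries]
  refine tsum_congr fun n => ?_
  rw [← Complex.exp_nat_mul, Complex.ofReal_natCast, mul_neg]

lemma tendsto_eulerPhi_sector {a : ℝ} (ha : 0 < a) :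
    Tendsto (fun z : ℝ × ℝ => eulerPhi (Complex.exp (-(a / (z.1 * (1 + z.2 * Complex.I))))))
      (𝓝[>] 0 ×ˢ 𝓝 0) (𝓝 1) := by
  refine Metric.tendsto_nhds.2 fun ε hε => ?_
  obtain ⟨x₀, hx₀, h⟩ := eventually_norm_eulerPhi_sub_one_lt (K := 1) ha hε
  filter_upwards [prod_mem_prod (Ioo_mem_nhdsGT hx₀)
    (Icc_mem_nhds (neg_lt_zero.2 one_pos) (one_pos : (0 : ℝ) < 1))] with z hz
  rw [dist_eq_norm]
  exact h z.1 hz.1.1 hz.1.2 z.2 (abs_le.2 hz.2)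

/-- The saddle point asymptotics for the coefficients of a power series that is dominated by its
values near the positive real axis. -/
lemma tendsto_coeff_of_genFun {a : ℕ → ℕ} {F : ℂ → ℂ} {g : ℝ → ℝ} {h : ℝ → ℝ → ℂ}
    {A B x₀ : ℝ} (hA : 0 < A) (hx₀ : 0 < x₀) (hx₀' : x₀ ≤ 1 / 4)
    (hF : ∀ w : ℂ, ‖w‖ < 1 →
      (Summable fun n => (a n : ℝ) * ‖w‖ ^ n) ∧ ∑' n, (a n : ℂ) * w ^ n = F w)
    (hdom : ∀ w : ℂ, ‖w‖ < 1 →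
      ‖F w‖ ≤ ‖F ‖w‖‖ * Real.exp (-((‖w‖ / (1 - ‖w‖) - (w / (1 - w)).re) / 4)))
    (hg : ∀ x, 0 < x → 0 < g x)
    (hmaj : ∀ s : ℂ, ∀ x u : ℝ, 0 < x → s = x * (1 + u * Complex.I) →
      F (Complex.exp (-s)) = g x * Complex.exp (A / s) * h x u)
    (hB : ∀ x, 0 < x → x < x₀ → ∀ u, |u| ≤ Real.pi → ‖h x u‖ ≤ B)
    (hlim : Tendsto (fun z : ℝ × ℝ => h z.1 z.2) (𝓝[>] 0 ×ˢ 𝓝 0) (𝓝 1)) :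
    Tendsto (fun n : ℕ => (a n : ℝ) / (g (A / √(A * n)) * Real.exp (2 * √(A * n)) *
      (A / √(A * n) / √√(A * n)))) atTop (𝓝 (√Real.pi / (2 * Real.pi))) := by
  have hre : ∀ x u : ℝ, (x * (1 + u * Complex.I) : ℂ).re = x := by intro x u; simp
  refine tendsto_coeff (a := fun n => (a n : ℝ)) (B := B) (δ := 1 / 16) hA Real.pi_pos
    (by norm_num) hx₀ (fun x hx => ?_) hg
    (fun x hx _ u _ => ?_) hB hlim (fun x hx hxx y hy hy' => ?_)
  · have hw : ‖Complex.exp (-(x : ℂ))‖ < 1 := norm_cexp_neg_lt_one (by simpa using hx)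
    refine (hF _ hw).1.congr fun n => ?_
    rw [Complex.norm_exp, ← Real.exp_nat_mul, Nat.abs_cast]
    simp
  · rw [expSeries_eq_tsum_pow, (hF _ (norm_cexp_neg_lt_one (by rwa [hre]))).2]
    exact hmaj _ x u hx rfl
  · have hw : ‖Complex.exp (-(x + y * Complex.I))‖ < 1 :=
      norm_cexp_neg_lt_one (by simpa using hx)
    have hn : ((‖Complex.exp (-(x + y * Complex.I))‖ : ℝ) : ℂ) = Complex.exp (-x) := by
      rw [Complex.norm_exp]; simp
    rw [expSeries_eq_tsum_pow, (hF _ hw).2]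
    have hs := minor_arc_saving hx (hxx.trans_le hx₀') hy hy' rfl
    refine (hdom _ hw).trans ?_
    rw [hn, hmaj x x 0 hx (by simp), norm_mul, norm_mul, ← Complex.ofReal_div,
      ← Complex.ofReal_exp, Complex.norm_real, Complex.norm_real, Real.norm_of_nonneg (hg x hx).le,
      Real.norm_of_nonneg (Real.exp_pos _).le]
    have hb := hB x hx hxx 0 (by simpa using Real.pi_pos.le)
    have hgx := hg x hx
    have hB0 : 0 ≤ B := (norm_nonneg _).trans hb
    have he : Real.exp ((A - 1 / 16) / x) = Real.exp (A / x) * Real.exp (-(1 / (4 * x) / 4)) := by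
      rw [← Real.exp_add]; congr 1; field_simp; ring
    rw [he, mul_assoc, mul_assoc, mul_left_comm B]
    gcongr

lemma norm_csqrt_sq (z : ℂ) : ‖Complex.sqrt z‖ ^ 2 = ‖z‖ := by
  rw [← norm_pow, Complex.sqrt]
  congr 1
  exact_mod_cast Complex.cpow_nat_inv_pow z two_ne_zero

lemma inv_norm_le_two {z : ℂ} (hz : ‖z - 1‖ < 1 / 2) : ‖z⁻¹‖ ≤ 2 := by
  have h : 1 ≤ ‖z‖ + ‖z - 1‖ := by
    simpa using norm_sub_le z (z - 1)
  rw [norm_inv]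
  exact inv_le_of_inv_le₀ two_pos (by linarith)

lemma tendsto_saddle_variable :
    Tendsto (fun z : ℝ × ℝ => (z.1 * (1 + z.2 * Complex.I) : ℂ)) (𝓝[>] 0 ×ˢ 𝓝 0) (𝓝 0) := by
  have h : Continuous fun z : ℝ × ℝ => (z.1 * (1 + z.2 * Complex.I) : ℂ) := by fun_prop
  have h0 := h.tendsto (0, 0)
  rw [nhds_prod_eq] at h0
  simpa using h0.mono_left (Filter.prod_mono nhdsWithin_le_nhds le_rfl)

lemma tendsto_p : Tendsto (fun n : ℕ => (p n : ℝ) /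
    (√(Real.pi ^ 2 / 6 / √(Real.pi ^ 2 / 6 * n) / (2 * Real.pi)) *
      Real.exp (2 * √(Real.pi ^ 2 / 6 * n)) *
      (Real.pi ^ 2 / 6 / √(Real.pi ^ 2 / 6 * n) / √√(Real.pi ^ 2 / 6 * n)))) atTop
    (𝓝 (√Real.pi / (2 * Real.pi))) := by
  have hpi := Real.pi_pos
  have ha : 0 < 4 * Real.pi ^ 2 := by positivity
  obtain ⟨x₁, hx₁, h₁⟩ := eventually_norm_eulerPhi_sub_one_lt (K := Real.pi) ha one_half_pos
  refine tendsto_coeff_of_genFun (F := fun w => (eulerPhi w)⁻¹)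
    (g := fun x => √(x / (2 * Real.pi))) (x₀ := min x₁ (1 / 4)) (B := 3 * 1 * 2)
    (h := fun x u => Complex.sqrt (1 + u * Complex.I) *
      Complex.exp (-(x * (1 + u * Complex.I)) / 24) *
      (eulerPhi (Complex.exp (-((4 * Real.pi ^ 2 : ℝ) / (x * (1 + u * Complex.I))))))⁻¹)
    (by positivity) (lt_min hx₁ (by norm_num)) (min_le_right _ _) (fun w hw => p_genFun hw)
    (fun w hw => norm_p_genFun_le hw) (fun x hx => by positivity) ?_ ?_ ?_
  · rintro _ x u hx rfl
    have hu : (1 + u * Complex.I : ℂ) ≠ 0 := fun h => by simpa using congrArg Complex.re h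
    have hd : (x * (1 + u * Complex.I) : ℂ) / (2 * Real.pi) =
        ((x / (2 * Real.pi) : ℝ) : ℂ) * (1 + u * Complex.I) := by
      push_cast; ring
    rw [eulerPhi_inv_eq (by simpa using hx), hd, csqrt_ofReal_mul (by positivity) hu]
    ring
  · intro x hx hx' u hu
    have h1 : ‖Complex.sqrt (1 + u * Complex.I)‖ ≤ 3 := by
      refine le_of_sq_le_sq ?_ (by norm_num)
      rw [norm_csqrt_sq]
      refine (norm_add_le _ _).trans ?_
      rw [norm_mul, Complex.norm_I, Complex.norm_real, Real.norm_eq_abs, norm_one]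
      linarith [Real.pi_le_four]
    have h2 : ‖Complex.exp (-(x * (1 + u * Complex.I)) / 24)‖ ≤ 1 := by
      rw [Complex.norm_exp, Real.exp_le_one_iff]
      have : (-(x * (1 + u * Complex.I)) / 24 : ℂ).re = -x / 24 := by
        rw [show (-(x * (1 + u * Complex.I)) / 24 : ℂ) = ((-x / 24 : ℝ) : ℂ) * (1 + u * Complex.I)
          by push_cast; ring]
        simp
      rw [this]
      linarith
    have h3 := inv_norm_le_two (h₁ x hx (hx'.trans_le (min_le_left _ _)) u hu)
    rw [norm_mul, norm_mul]
    gcongr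
  · have h1 : Tendsto (fun z : ℝ × ℝ => Complex.sqrt (1 + z.2 * Complex.I))
        (𝓝[>] 0 ×ˢ 𝓝 0) (𝓝 1) := by
      have hc : ContinuousAt (fun u : ℝ => Complex.sqrt (1 + u * Complex.I)) 0 := by
        refine ContinuousAt.cpow (by fun_prop) continuousAt_const ?_
        simp
      have := hc.tendsto.comp (tendsto_snd (f := 𝓝[>] (0 : ℝ)) (g := 𝓝 (0 : ℝ)))
      simpa [Function.comp_def] using this
    have h2 : Tendsto (fun z : ℝ × ℝ => Complex.exp (-(z.1 * (1 + z.2 * Complex.I)) / 24))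
        (𝓝[>] 0 ×ˢ 𝓝 0) (𝓝 1) := by
      simpa using (tendsto_saddle_variable.neg.div_const 24).cexp
    simpa using (h1.mul h2).mul ((tendsto_eulerPhi_sector ha).inv₀ one_ne_zero)

lemma tendsto_q : Tendsto (fun n : ℕ => (q n : ℝ) / ((√2)⁻¹ *
      Real.exp (2 * √(Real.pi ^ 2 / 12 * n)) *
      (Real.pi ^ 2 / 12 / √(Real.pi ^ 2 / 12 * n) / √√(Real.pi ^ 2 / 12 * n)))) atTop
    (𝓝 (√Real.pi / (2 * Real.pi))) := by
  have hpi := Real.pi_pos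
  have ha : 0 < 4 * Real.pi ^ 2 := by positivity
  have hb : 0 < 2 * Real.pi ^ 2 := by positivity
  obtain ⟨x₁, hx₁, h₁⟩ := eventually_norm_eulerPhi_sub_one_lt (K := Real.pi) ha one_half_pos
  obtain ⟨x₂, hx₂, h₂⟩ := eventually_norm_eulerPhi_sub_one_lt (K := Real.pi) hb one_half_pos
  refine tendsto_coeff_of_genFun (F := fun w => eulerPhi (w ^ 2) / eulerPhi w)
    (g := fun _ => (√2)⁻¹) (x₀ := min (min x₁ x₂) (1 / 4)) (B := Real.exp 1 * 2 * 2)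
    (h := fun x u => Complex.exp (x * (1 + u * Complex.I) / 24) *
      eulerPhi (Complex.exp (-((2 * Real.pi ^ 2 : ℝ) / (x * (1 + u * Complex.I))))) *
      (eulerPhi (Complex.exp (-((4 * Real.pi ^ 2 : ℝ) / (x * (1 + u * Complex.I))))))⁻¹)
    (by positivity) (lt_min (lt_min hx₁ hx₂) (by norm_num)) (min_le_right _ _)
    (fun w hw => q_genFun hw)
    (fun w hw => norm_q_genFun_le hw) (fun x hx => by positivity) ?_ ?_ ?_
  · rintro s x u hx hs
    have hre : 0 < s.re := by rw [hs]; simpa using hx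
    have hs0 : s ≠ 0 := by rintro rfl; simp at hre
    have hre2 : 0 < (2 * s).re := by simpa using hre
    have hpi0 : (Real.pi : ℂ) ≠ 0 := Complex.ofReal_ne_zero.2 Real.pi_ne_zero
    have hsp : s / (2 * Real.pi) ≠ 0 := div_ne_zero hs0 (mul_ne_zero two_ne_zero hpi0)
    have hsq : Complex.sqrt (2 * s / (2 * Real.pi)) =
        (√2 : ℝ) * Complex.sqrt (s / (2 * Real.pi)) := by
      rw [← csqrt_ofReal_mul two_pos hsp]
      congr 1
      push_cast
      ring
    have hpow : Complex.exp (-s) ^ 2 = Complex.exp (-(2 * s)) := by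
      rw [← Complex.exp_nat_mul]
      congr 1
      push_cast
      ring
    have harg : ((4 * Real.pi ^ 2 : ℝ) : ℂ) / (2 * s) = (2 * Real.pi ^ 2 : ℝ) / s := by
      push_cast
      field_simp
      norm_num
    have hroot : Complex.sqrt (s / (2 * Real.pi)) ≠ 0 := by simp [Complex.sqrt, hsp]
    have htwo : ((√2 : ℝ) : ℂ) ≠ 0 := by simp
    have e1 : Complex.exp (-s / 24) = Complex.exp (-(2 * s) / 24) * Complex.exp (s / 24) := by
      rw [← Complex.exp_add]; congr 1; ring
    have e2 : Complex.exp ((Real.pi ^ 2 / 6 : ℝ) / s) =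
        Complex.exp ((Real.pi ^ 2 / 6 : ℝ) / (2 * s)) * Complex.exp ((Real.pi ^ 2 / 12 : ℝ) / s) := by
      rw [← Complex.exp_add]; congr 1; push_cast; field_simp; norm_num
    have h1 := eulerPhi_inv_eq hre
    have h2 := eulerPhi_inv_eq hre2
    rw [hsq, harg] at h2
    rw [← hs, hpow, div_eq_mul_inv, h1, e1, e2, ← inv_inv (eulerPhi (Complex.exp (-(2 * s)))), h2]
    have n1 := Complex.exp_ne_zero (-(2 * s) / 24)
    have n2 := Complex.exp_ne_zero ((Real.pi ^ 2 / 6 : ℝ) / (2 * s))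
    simp only [mul_inv, inv_inv, Complex.ofReal_inv]
    generalize Complex.exp (-(2 * s) / 24) = E at n1 ⊢
    generalize Complex.exp ((Real.pi ^ 2 / 6 : ℝ) / (2 * s)) = E' at n2 ⊢
    generalize Complex.sqrt (s / (2 * Real.pi)) = R at hroot ⊢
    generalize Complex.exp ((Real.pi ^ 2 / 12 : ℝ) / s) = G
    generalize Complex.exp (s / 24) = H
    generalize (eulerPhi (Complex.exp (-((4 * Real.pi ^ 2 : ℝ) / s))))⁻¹ = Y
    field_simp
  · intro x hx hx' u hu
    have hxm := lt_min_iff.1 hx'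
    have hxm1 := lt_min_iff.1 hxm.1
    have h2 : ‖Complex.exp (x * (1 + u * Complex.I) / 24)‖ ≤ Real.exp 1 := by
      rw [Complex.norm_exp, Real.exp_le_exp]
      have : (x * (1 + u * Complex.I) / 24 : ℂ).re = x / 24 := by
        rw [show (x * (1 + u * Complex.I) / 24 : ℂ) = ((x / 24 : ℝ) : ℂ) * (1 + u * Complex.I)
          by push_cast; ring]
        simp
      rw [this]
      linarith [hxm.2]
    have h3 := inv_norm_le_two (h₁ x hx hxm1.1 u hu)
    have h4 := h₂ x hx hxm1.2 u hu
    have h5 : ‖eulerPhi (Complex.exp (-((2 * Real.pi ^ 2 : ℝ) / (x * (1 + u * Complex.I)))))‖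
        ≤ 2 := by
      refine (norm_le_norm_add_norm_sub' _ 1).trans ?_
      rw [norm_one]
      linarith
    rw [norm_mul, norm_mul]
    gcongr
  · have h2 : Tendsto (fun z : ℝ × ℝ => Complex.exp (z.1 * (1 + z.2 * Complex.I) / 24))
        (𝓝[>] 0 ×ˢ 𝓝 0) (𝓝 1) := by
      simpa using (tendsto_saddle_variable.div_const 24).cexp
    simpa using (h2.mul (tendsto_eulerPhi_sector hb)).mul
      ((tendsto_eulerPhi_sector ha).inv₀ one_ne_zero)

end PartitionAsymptotics

namespace PartitionAsymptotics

lemma amplitude_ratio {x : ℝ} (hx : 0 < x) :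
    (√2)⁻¹ * (Real.pi ^ 2 / 12 / √(Real.pi ^ 2 / 12 * x) / √√(Real.pi ^ 2 / 12 * x)) /
      (√(Real.pi ^ 2 / 6 / √(Real.pi ^ 2 / 6 * x) / (2 * Real.pi)) *
        (Real.pi ^ 2 / 6 / √(Real.pi ^ 2 / 6 * x) / √√(Real.pi ^ 2 / 6 * x))) =
      (3 * x) ^ (1 / 4 : ℝ) := by
  have hpi := Real.pi_pos
  have hM : 0 < √(Real.pi ^ 2 / 6 * x) := by positivity
  have hN : 0 < √(Real.pi ^ 2 / 12 * x) := by positivity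
  have hM2 : √(Real.pi ^ 2 / 6 * x) ^ 2 = Real.pi ^ 2 / 6 * x := Real.sq_sqrt (by positivity)
  have hN2 : √(Real.pi ^ 2 / 12 * x) ^ 2 = Real.pi ^ 2 / 12 * x := Real.sq_sqrt (by positivity)
  generalize √(Real.pi ^ 2 / 6 * x) = M at hM hM2 ⊢
  generalize √(Real.pi ^ 2 / 12 * x) = N at hN hN2 ⊢
  have hr {z : ℝ} (hz : 0 < z) : √z ^ 4 = z ^ 2 := by
    rw [show 4 = 2 * 2 from rfl, pow_mul, Real.sq_sqrt hz.le]
  rw [one_div, Real.eq_rpow_inv (by positivity) (by positivity) four_ne_zero, Real.rpow_ofNat]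
  rw [div_pow, mul_pow, mul_pow, inv_pow, hr two_pos, hr (by positivity), div_pow _ √N,
    div_pow _ √M, hr hN, hr hM]
  have hM6 : M ^ 6 = (Real.pi ^ 2 / 6 * x) ^ 3 := by rw [← hM2]; ring
  have hN6 : N ^ 6 = (Real.pi ^ 2 / 12 * x) ^ 3 := by rw [← hN2]; ring
  have key : ((2 : ℝ) ^ 2)⁻¹ * ((Real.pi ^ 2 / 12 / N) ^ 4 / N ^ 2) /
      ((Real.pi ^ 2 / 6 / M / (2 * Real.pi)) ^ 2 * ((Real.pi ^ 2 / 6 / M) ^ 4 / M ^ 2)) =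
      9 / 4 / Real.pi ^ 2 * (M ^ 6 * M ^ 2 / N ^ 6) := by
    field_simp
    norm_num
  rw [key, hM6, hN6, hM2]
  field_simp
  norm_num

lemma exponent_ratio (x : ℝ) :
    2 * √(Real.pi ^ 2 / 12 * x) - 2 * √(Real.pi ^ 2 / 6 * x) =
      -(c * √x * (1 - 1 / √2)) := by
  have h : √(Real.pi ^ 2 / 12 * x) = √(Real.pi ^ 2 / 6) * √x / √2 := by
    rw [← Real.sqrt_mul (by positivity), ← Real.sqrt_div' _ zero_le_two]
    congr 1
    ring
  rw [h, Real.sqrt_mul (by positivity), c]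
  ring

end PartitionAsymptotics

/-- `q n / p n ∼ (3n)^{1/4} e^{−c√n(1 − 1/√2)}` as `n → ∞`. -/
theorem distincts_proportion :
    Tendsto (fun n : ℕ =>
        ((q n : ℝ) / (p n : ℝ)) /
          ((3 * (n : ℝ)) ^ (1 / 4 : ℝ) *
            Real.exp (-(c * Real.sqrt n * (1 - 1 / Real.sqrt 2)))))
      atTop (nhds 1) := by
  have hL : √Real.pi / (2 * Real.pi) ≠ 0 := by
    have := Real.pi_pos
    positivity
  have h := PartitionAsymptotics.tendsto_q.div PartitionAsymptotics.tendsto_p hL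
  rw [div_self hL] at h
  refine h.congr' ?_
  filter_upwards [eventually_gt_atTop 0] with n hn
  rw [← PartitionAsymptotics.amplitude_ratio (Nat.cast_pos.2 hn),
    ← PartitionAsymptotics.exponent_ratio, Real.exp_sub, Pi.div_apply, div_div_div_comm]
  congr 1
  ring
end

section
/- For every real number x with 0 ≤ x ≤ 1, √(1+x) + √(1−x) ≤ 2 − x²/4. -/
/-- For every real `x` with `0 ≤ x ≤ 1`, `√(1+x) + √(1−x) ≤ 2 − x²/4`. -/
theorem sqrt_add_sqrt_le (x : ℝ) (hx0 : 0 ≤ x) (hx1 : x ≤ 1) :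
    Real.sqrt (1 + x) + Real.sqrt (1 - x) ≤ 2 - x ^ 2 / 4 := by
  have ha : Real.sqrt (1 + x) ^ 2 = 1 + x := Real.sq_sqrt (by linarith)
  have hb : Real.sqrt (1 - x) ^ 2 = 1 - x := Real.sq_sqrt (by linarith)
  have hx : x ^ 2 ≤ 1 := pow_le_one₀ hx0 hx1
  have hab : Real.sqrt (1 + x) * Real.sqrt (1 - x) ≤ 1 - x ^ 2 / 2 := by
    refine (pow_le_pow_iff_left₀ (by positivity) (by linarith) two_ne_zero).mp ?_
    rw [mul_pow, ha, hb]
    nlinarith [sq_nonneg (x ^ 2)]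
  refine (pow_le_pow_iff_left₀ (by positivity) (by linarith) two_ne_zero).mp ?_
  rw [add_sq, ha, hb]
  nlinarith [sq_nonneg (x ^ 2)]
end
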